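/- arXiv:2412.05750 — 3 statements merged into one kernel-verified Lean document; each statement's English description precedes it below -/
import Mathlib

section
/- Let x, y, a, b, c be integers with 1 < x < y, b ≥ 0, c ≥ 0 and a ≥ x + y − 1. Then the multiset {1^a, x^b, y^c} has a linear realization. -/
/-- The multiset of absolute differences of consecutive entries of a list of naturals. -/
def linDiffs (l : List ℕ) : Multiset ℕ :=
  ↑(List.zipWith (fun a b => (a - b) + (b - a)) l l.tail)

/-- `l` is a linear realization of the multiset `L`: it lists `0, …, |L|`
(each exactly once) and its consecutive absolute differences form `L`. -/
def IsLinearRealization (L : Multiset ℕ) (l : List ℕ) : Prop :=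
  l.Perm (List.range (Multiset.card L + 1)) ∧ linDiffs l = L

def HasLinearRealization (L : Multiset ℕ) : Prop :=
  ∃ l : List ℕ, IsLinearRealization L l

/-- A standard linear realization starts at `0`. -/
def HasStandardLinearRealization (L : Multiset ℕ) : Prop :=
  ∃ l : List ℕ, IsLinearRealization L l ∧ l.head? = some 0

/-- A perfect linear realization starts at `0` and ends at `v - 1 = |L|`. -/
def HasPerfectLinearRealization (L : Multiset ℕ) : Prop :=
  ∃ l : List ℕ, IsLinearRealization L l ∧ l.head? = some 0 ∧
    l.getLast? = some (Multiset.card L)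

/-- The multiset of cyclic edge-lengths `min(|gᵢ₊₁ - gᵢ|, v - |gᵢ₊₁ - gᵢ|)`
of consecutive entries of a list of naturals. -/
def cycDiffs (v : ℕ) (l : List ℕ) : Multiset ℕ :=
  ↑(List.zipWith (fun a b => min ((a - b) + (b - a)) (v - ((a - b) + (b - a)))) l l.tail)

/-- `L` is (cyclically) realizable in `K_v`: some Hamiltonian path on the vertex
set `{0, …, v-1}` has `L` as its multiset of edge-lengths. -/
def IsRealizable (v : ℕ) (L : Multiset ℕ) : Prop :=
  ∃ l : List ℕ, l.Perm (List.range v) ∧ cycDiffs v l = L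

/-- The multiset `{1^a, x^b, y^c}`. -/
def mset3 (a b c x y : ℕ) : Multiset ℕ :=
  Multiset.replicate a 1 + Multiset.replicate b x + Multiset.replicate c y

/-- With `b = q'x + r'`, `0 ≤ r' < x`: `ω(x,b) = x - 1` if `q' = 0`, `r' = 1`,
or at least one of `x`, `r'` is even; otherwise `ω(x,b) = x`. -/
def omegaBHR (x b : ℕ) : ℕ :=
  if b / x = 0 ∨ b % x = 1 ∨ Even x ∨ Even (b % x) then x - 1 else x

/-- The reduced form `ĝ = min(g, v - g)`. -/
def reducedForm (v g : ℕ) : ℕ := min g (v - g)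

/-- The function `f` of Theorem 3.7 (counterexample characterization refined). -/
def fBHR (u w : ℕ) : ℕ :=
  if Even u ∧ Even w then w - 1
  else if u = 3 ∨ (Even u ∧ ¬ Even w) then u + w - 2
  else u + w - 1

/-- A multiset `L` of size `v - 1` with elements in `{1, …, ⌊v/2⌋}` is admissible
if for every divisor `d` of `v` the number of elements of `L` divisible by `d`
is at most `v - d`. -/
def IsAdmissible (v : ℕ) (L : Multiset ℕ) : Prop :=
  Multiset.card L = v - 1 ∧ (∀ z ∈ L, 1 ≤ z ∧ z ≤ v / 2) ∧
  ∀ d : ℕ, d ∣ v → Multiset.card (L.filter (fun z => d ∣ z)) ≤ v - d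

theorem linDiffs_append_cons (l : List ℕ) (e : ℕ) (t : List ℕ) :
    linDiffs (l ++ e :: t) = linDiffs (l ++ [e]) + linDiffs (e :: t) := by
  induction l with
  | nil => simp [linDiffs]
  | cons a l ih =>
    cases l with
    | nil =>
      simp [linDiffs, ← Multiset.cons_coe]
    | cons b l =>
      simp only [linDiffs, List.cons_append, List.tail_cons, List.zipWith_cons_cons,
        ← Multiset.cons_coe, Multiset.cons_add] at ih ⊢
      rw [ih]

theorem linDiffs_reverse (l : List ℕ) : linDiffs l.reverse = linDiffs l := by
  induction l with
  | nil => rfl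
  | cons a l ih =>
    cases l with
    | nil => rfl
    | cons b l =>
      have h := linDiffs_append_cons l.reverse b [a]
      have h' := linDiffs_append_cons [a] b l
      simp only [List.reverse_cons, List.append_assoc, List.cons_append, List.nil_append]
        at ih h h' ⊢
      rw [h, h', ih, add_comm]
      congr 1
      simp [linDiffs, add_comm]

theorem linDiffs_map {f : ℕ → ℕ} {l : List ℕ}
    (hf : ∀ a ∈ l, ∀ b ∈ l, (f a - f b) + (f b - f a) = (a - b) + (b - a)) :
    linDiffs (l.map f) = linDiffs l := by
  induction l with
  | nil => rfl
  | cons a l ih =>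
    cases l with
    | nil => rfl
    | cons b l =>
      have h := ih fun u hu w hw => hf u (by simp [hu]) w (by simp [hw])
      have h' := hf a (by simp) b (by simp)
      simp only [linDiffs, List.map_cons, List.tail_cons, List.zipWith_cons_cons,
        ← Multiset.cons_coe] at h ⊢
      rw [h, h']

theorem mset3_add (a b c a' b' c' x y : ℕ) :
    mset3 a b c x y + mset3 a' b' c' x y = mset3 (a + a') (b + b') (c + c') x y := by
  simp only [mset3, Multiset.replicate_add]
  abel

/-- `S` is the vertex set of a path from `s` to `e` whose edge lengths form `{1^a, x^b, y^c}`. -/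
def GridPath (x y : ℕ) (S : ℕ → Prop) (s e a b c : ℕ) : Prop :=
  ∃ l : List ℕ, l.Nodup ∧ (∀ n, n ∈ l ↔ S n) ∧ l.head? = some s ∧ l.getLast? = some e ∧
    linDiffs l = mset3 a b c x y

namespace GridPath

variable {x y : ℕ} {S T U : ℕ → Prop} {s e s' e' a b c a' b' c' : ℕ}

theorem single (hS : ∀ n, S n ↔ n = s) : GridPath x y S s s 0 0 0 :=
  ⟨[s], by simp, by simp [hS], rfl, rfl, rfl⟩

theorem reverse (h : GridPath x y S s e a b c) : GridPath x y S e s a b c := by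
  obtain ⟨l, h1, h2, h3, h4, h5⟩ := h
  exact ⟨l.reverse, by simpa using h1, by simpa using h2, by simpa using h4, by simpa using h3,
    by rw [linDiffs_reverse, h5]⟩

theorem congr (h : GridPath x y S s e a b c) (hS : ∀ n, T n ↔ S n)
    (hs : s = s') (he : e = e') (ha : a = a') (hb : b = b') (hc : c = c') :
    GridPath x y T s' e' a' b' c' := by
  subst hs he ha hb hc
  rwa [show T = S from funext fun n => propext (hS n)]

theorem map (h : GridPath x y S s e a b c) (f : ℕ → ℕ)
    (hf : ∀ u w, S u → S w → (f u - f w) + (f w - f u) = (u - w) + (w - u))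
    (hT : ∀ n, T n ↔ ∃ m, S m ∧ f m = n) : GridPath x y T (f s) (f e) a b c := by
  obtain ⟨l, h1, h2, h3, h4, h5⟩ := h
  refine ⟨l.map f, ?_, ?_, by simp [h3], by simp [h4], ?_⟩
  · refine List.Nodup.map_on ?_ h1
    intro u hu w hw huw
    have := hf u w ((h2 u).1 hu) ((h2 w).1 hw)
    omega
  · intro n
    simp [hT, h2]
  · rw [linDiffs_map, h5]
    exact fun u hu w hw => hf u w ((h2 u).1 hu) ((h2 w).1 hw)

theorem merge (h : GridPath x y S s e a b c) (h' : GridPath x y T e e' a' b' c')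
    (hU : ∀ n, U n ↔ S n ∨ T n) (hd : ∀ n, S n → T n → n = e) :
    GridPath x y U s e' (a + a') (b + b') (c + c') := by
  obtain ⟨l, h1, h2, h3, h4, h5⟩ := h
  obtain ⟨l', h1', h2', h3', h4', h5'⟩ := h'
  obtain ⟨k, rfl⟩ := List.getLast?_eq_some_iff.1 h4
  obtain ⟨t, rfl⟩ := List.head?_eq_some_iff.1 h3'
  refine ⟨k ++ e :: t, ?_, ?_, ?_, ?_, ?_⟩
  · rw [List.nodup_append] at h1 ⊢
    refine ⟨h1.1, h1', ?_⟩
    rintro u hu w hw rfl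
    have := hd u ((h2 u).1 (by simp [hu])) ((h2' u).1 hw)
    exact h1.2.2 u hu e (by simp) this
  · intro n
    rw [hU, ← h2, ← h2']
    simp only [List.mem_append, List.mem_cons, List.not_mem_nil]
    tauto
  · cases k with
    | nil => simpa using h3
    | cons => simpa using h3
  · simpa using h4'
  · rw [linDiffs_append_cons, h5, h5', mset3_add]

theorem pair (d : ℕ) (h : e + d = s ∨ s + d = e) (hd : 0 < d)
    (hL : mset3 a b c x y = {d}) : GridPath x y (fun n => n = e ∨ n = s) e s a b c := by
  refine ⟨[e, s], by simp; omega, by simp, rfl, rfl, ?_⟩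
  rw [hL]
  have : e - s + (s - e) = d := by omega
  simp [linDiffs, this]

theorem append_edge (h : GridPath x y S s e a b c) (h' : GridPath x y T s' e' a' b' c')
    {a'' b'' c'' : ℕ} (hp : GridPath x y (fun n => n = e ∨ n = s') e s' a'' b'' c'')
    (hU : ∀ n, U n ↔ S n ∨ T n) (hd : ∀ n, S n → ¬ T n) :
    GridPath x y U s e' (a + a'' + a') (b + b'' + b') (c + c'' + c') := by
  have he : S e := by
    obtain ⟨l, -, h2, -, h4, -⟩ := h
    exact (h2 e).1 (List.mem_of_getLast? h4)
  have hs' : T s' := by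
    obtain ⟨l, -, h2, h3, -, -⟩ := h'
    exact (h2 s').1 (List.mem_of_head? h3)
  refine (h.merge (U := fun n => S n ∨ n = s') hp ?_ ?_).merge h' ?_ ?_
  · intro n
    constructor
    · tauto
    · rintro (h | rfl | rfl) <;> tauto
  · rintro n hn (rfl | rfl)
    · rfl
    · exact absurd hs' (hd _ hn)
  · intro n
    rw [hU]
    constructor
    · tauto
    · rintro ((h | rfl) | h) <;> tauto
  · rintro n (hn | rfl) hn'
    · exact absurd hn' (hd _ hn)
    · rfl

theorem append_one (h : GridPath x y S s e a b c) (h' : GridPath x y T s' e' a' b' c')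
    (hl : e + 1 = s' ∨ s' + 1 = e) (hU : ∀ n, U n ↔ S n ∨ T n) (hd : ∀ n, S n → ¬ T n) :
    GridPath x y U s e' (a + 1 + a') (b + b') (c + c') :=
  h.append_edge h' (pair (a := 1) (b := 0) (c := 0) 1 hl one_pos (by simp [mset3])) hU hd

theorem append_fst (hx : 0 < x) (h : GridPath x y S s e a b c)
    (h' : GridPath x y T s' e' a' b' c')
    (hl : e + x = s' ∨ s' + x = e) (hU : ∀ n, U n ↔ S n ∨ T n) (hd : ∀ n, S n → ¬ T n) :
    GridPath x y U s e' (a + a') (b + 1 + b') (c + c') :=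
  h.append_edge h' (pair (a := 0) (b := 1) (c := 0) x hl hx (by simp [mset3])) hU hd

theorem append_snd (hy : 0 < y) (h : GridPath x y S s e a b c)
    (h' : GridPath x y T s' e' a' b' c')
    (hl : e + y = s' ∨ s' + y = e) (hU : ∀ n, U n ↔ S n ∨ T n) (hd : ∀ n, S n → ¬ T n) :
    GridPath x y U s e' (a + a') (b + b') (c + 1 + c') :=
  h.append_edge h' (pair (a := 0) (b := 0) (c := 1) y hl hy (by simp [mset3])) hU hd

theorem hasLinearRealization {N : ℕ} (h : GridPath x y (· < N) s e a b c) :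
    HasLinearRealization (mset3 a b c x y) := by
  obtain ⟨l, h1, h2, h3, -, h5⟩ := h
  have hp : l.Perm (List.range N) :=
    (List.perm_ext_iff_of_nodup h1 List.nodup_range).2 (by simpa using h2)
  have hN : N = Multiset.card (mset3 a b c x y) + 1 := by
    have hl := hp.length_eq
    obtain ⟨t, rfl⟩ := List.head?_eq_some_iff.1 h3
    rw [← h5]
    simp [linDiffs] at hl ⊢
    omega
  exact ⟨l, hN ▸ hp, h5⟩

end GridPath

theorem eq_add_mul_iff {y i p : ℕ} (hi : i < y) (n : ℕ) :
    (n % y = i ∧ n / y = p) ↔ n = i + y * p := by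
  constructor
  · rintro ⟨rfl, rfl⟩
    exact (Nat.mod_add_div n y).symm
  · rintro rfl
    have hy : 0 < y := by omega
    simp [Nat.add_mul_div_left _ _ hy, Nat.div_eq_of_lt hi, Nat.mod_eq_of_lt hi]

theorem lt_succ_mul_add_iff {y q r : ℕ} (hr : r ≤ y) (hy : 0 < y) (n : ℕ) :
    n < (q + 1) * y + r ↔ n / y ≤ q ∨ (n / y = q + 1 ∧ n % y < r) := by
  have h1 := Nat.mod_add_div n y
  have h2 := Nat.mod_lt n hy
  rcases lt_trichotomy (n / y) (q + 1) with h | h | h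
  · have : y * (n / y + 1) ≤ y * (q + 1) := Nat.mul_le_mul_left y h
    constructor
    · omega
    · intro; nlinarith
  · rw [h] at h1
    constructor
    · intro; right; refine ⟨h, ?_⟩; nlinarith
    · rintro (h' | h')
      · omega
      · nlinarith
  · have : y * (q + 1 + 1) ≤ y * (n / y) := Nat.mul_le_mul_left y h
    constructor
    · intro hn
      exfalso
      rw [mul_comm] at hn
      simp only [mul_add] at this hn
      omega
    · omega

/-- The bottom row `0` for even `t` and the top row `q` for odd `t`. -/
def endRow (q t : ℕ) : ℕ := if t % 2 = 0 then 0 else q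

theorem endRow_of_even {q t : ℕ} (h : t % 2 = 0) : endRow q t = 0 := if_pos h

theorem endRow_of_odd {q t : ℕ} (h : t % 2 = 1) : endRow q t = q := if_neg (by omega)

namespace GridPath

variable {x y : ℕ}

theorem column {i : ℕ} (hi : i < y) (p k : ℕ) :
    GridPath x y (fun n => n % y = i ∧ p ≤ n / y ∧ n / y ≤ p + k)
      (i + y * p) (i + y * (p + k)) 0 0 k := by
  induction k with
  | zero =>
    refine single fun n => ?_
    rw [← eq_add_mul_iff hi]
    omega
  | succ k ih =>
    have h := ih.append_snd (y := y) (by omega)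
      (single (s := i + y * (p + k + 1)) (S := fun n => n % y = i ∧ n / y = p + k + 1)
        (eq_add_mul_iff hi))
      (U := fun n => n % y = i ∧ p ≤ n / y ∧ n / y ≤ p + (k + 1))
      (by left; ring) (by intro n; omega) (by intro n; omega)
    exact h

theorem column_zero {i : ℕ} (hi : i < y) (k : ℕ) :
    GridPath x y (fun n => n % y = i ∧ n / y ≤ k) i (i + y * k) 0 0 k :=
  (column hi 0 k).congr (by simp) (by simp) (by simp) rfl rfl rfl

theorem column_endRow {i : ℕ} (hi : i < y) (q t : ℕ) :
    GridPath x y (fun n => n % y = i ∧ n / y ≤ q)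
      (i + y * endRow q t) (i + y * endRow q (t + 1)) 0 0 q := by
  have h := column_zero (x := x) hi q
  rcases Nat.mod_two_eq_zero_or_one t with ht | ht
  · rw [endRow_of_even ht, endRow_of_odd (by omega)]
    exact h.congr (fun n => Iff.rfl) (by simp) rfl rfl rfl rfl
  · rw [endRow_of_odd ht, endRow_of_even (by omega)]
    exact h.reverse.congr (fun n => Iff.rfl) rfl (by simp) rfl rfl rfl

/-- Columns `i, …, i + m` modulo `y`, of equal height, traversed alternately up and down. -/
theorem snake {i m : ℕ} (hi : i + m < y) (q t : ℕ) :
    GridPath x y (fun n => i ≤ n % y ∧ n % y ≤ i + m ∧ n / y ≤ q)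
      (i + y * endRow q t) (i + m + y * endRow q (t + m + 1)) m 0 ((m + 1) * q) := by
  induction m with
  | zero =>
    exact (column_endRow hi q t).congr (by intro n; omega) rfl rfl rfl rfl (by ring)
  | succ m ih =>
    exact ((ih (by omega)).append_one (column_endRow hi q (t + m + 1))
      (U := fun n => i ≤ n % y ∧ n % y ≤ i + (m + 1) ∧ n / y ≤ q)
      (by omega) (by intro n; omega) (by intro n; omega)).congr (by intro n; rfl) rfl rfl
      (by omega) rfl (by ring)

theorem snake_left {i m : ℕ} (hi : i + m < y) (q t : ℕ) :
    GridPath x y (fun n => i ≤ n % y ∧ n % y ≤ i + m ∧ n / y ≤ q)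
      (i + m + y * endRow q t) (i + y * endRow q (t + m + 1)) m 0 ((m + 1) * q) := by
  have h : endRow q (t + m + 1 + m + 1) = endRow q t := by
    rw [endRow, endRow, show (t + m + 1 + m + 1) % 2 = t % 2 by omega]
  have := (snake (x := x) hi q (t + m + 1)).reverse
  rwa [h] at this

/-- Column `0` upwards, followed by the one row lower columns `y - 1, …, r`. -/
theorem wrap {r : ℕ} (hr : 1 ≤ r) (hry : r < y) (q : ℕ) :
    GridPath x y (fun n => (n % y = 0 ∧ n / y ≤ q + 1) ∨ (r ≤ n % y ∧ n / y ≤ q))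
      0 (r + y * endRow q (y - r + 1)) (y - r) 0 (q + 1 + (y - r) * q) := by
  obtain ⟨m, rfl⟩ : ∃ m, y = r + m + 1 := ⟨y - r - 1, by omega⟩
  have h0 := column_zero (x := x) (y := r + m + 1) (i := 0) (by omega) (q + 1)
  have h1 := snake_left (x := x) (y := r + m + 1) (i := r) (m := m) (by omega) q 1
  have hlt : ∀ n, n % (r + m + 1) < r + m + 1 := fun n => Nat.mod_lt _ (by omega)
  refine (h0.append_one h1
    (U := fun n => (n % (r + m + 1) = 0 ∧ n / (r + m + 1) ≤ q + 1) ∨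
      (r ≤ n % (r + m + 1) ∧ n / (r + m + 1) ≤ q)) ?_ ?_ ?_).congr (by intro n; rfl) (by simp) ?_
      (by omega) rfl ?_
  · right
    rw [endRow_of_odd rfl]
    ring
  · intro n
    have := hlt n
    omega
  · intro n
    omega
  · rw [show 1 + m + 1 = r + m + 1 - r + 1 by omega]
  · rw [show r + m + 1 - r = m + 1 by omega]

/-- Two adjacent columns, from the top of the first one to the vertex just below it. -/
theorem hook {u w : ℕ} (hu : u < y) (hw : w < y) (h : u + 1 = w ∨ w + 1 = u) (q : ℕ) :
    GridPath x y (fun n => (n % y = u ∨ n % y = w) ∧ n / y ≤ q + 1)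
      (u + y * (q + 1)) (u + y * q) 2 0 (2 * q + 1) := by
  refine (((single (s := u + y * (q + 1)) (eq_add_mul_iff hu)).append_one
    (U := fun n => n % y = u ∧ n / y = q + 1 ∨ n % y = w ∧ n / y ≤ q + 1)
    (column_zero hw (q + 1)).reverse (by omega) ?_ ?_).append_one
    (U := fun n => (n % y = u ∨ n % y = w) ∧ n / y ≤ q + 1)
    (column_zero hu q) (by omega) ?_ ?_).congr
    (fun n => Iff.rfl) rfl (by simp) rfl rfl (by omega)
  all_goals intro n; omega

end GridPath

/-- The multiset `{1^a, x^b, y^c}` has a standard linear realization. -/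
def IsStandard (x y a b c : ℕ) : Prop :=
  ∃ N e : ℕ, GridPath x y (· < N) 0 e a b c

namespace IsStandard

variable {x y a b c a' b' c' : ℕ}

theorem add_ones (h : IsStandard x y a b c) (k : ℕ) : IsStandard x y (a + k) b c := by
  induction k with
  | zero => exact h
  | succ k ih =>
    obtain ⟨N, e, h⟩ := ih
    refine ⟨N + 1, e + 1, ((GridPath.single (S := (· = 0)) fun n => Iff.rfl).append_one
      (h.map (T := fun n => 0 < n ∧ n < N + 1) (· + 1) (by intros; omega) ?_)
      (by omega) ?_ ?_).congr (fun n => Iff.rfl) rfl rfl (by omega) (by omega) (by omega)⟩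
    · intro n
      constructor
      · rintro ⟨h1, h2⟩
        exact ⟨n - 1, by omega, by omega⟩
      · rintro ⟨m, h1, rfl⟩
        omega
    · intro n; omega
    · intro n; omega

theorem hasLinearRealization_add (h : IsStandard x y a b c) (h' : IsStandard x y a' b' c') :
    HasLinearRealization (mset3 (a + a') (b + b') (c + c') x y) := by
  obtain ⟨N, e, h⟩ := h
  obtain ⟨N', e', h'⟩ := h'
  have pos : ∀ {N e a b c : ℕ}, GridPath x y (· < N) 0 e a b c → 0 < N := by
    rintro N e a b c ⟨l, -, h2, h3, -⟩
    exact (h2 0).1 (List.mem_of_head? h3)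
  have hN := pos h
  have hN' := pos h'
  have h1 := h.reverse.map (T := (· < N)) (N - 1 - ·) (by intros; omega) fun n =>
    ⟨fun _ => ⟨N - 1 - n, by omega, by omega⟩, by rintro ⟨m, hm, rfl⟩; omega⟩
  have h2 := h'.map (T := fun n => N - 1 ≤ n ∧ n < N + N' - 1) (N - 1 + ·) (by intros; omega)
    fun n => ⟨fun _ => ⟨n - (N - 1), by omega, by omega⟩, by rintro ⟨m, hm, rfl⟩; omega⟩
  exact (h1.merge (U := (· < N + N' - 1)) h2 (by intro n; omega)
    (by intro n; omega)).hasLinearRealization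

theorem fst_of_snd {z : ℕ} (h : IsStandard z x a 0 b) : IsStandard x y a b 0 := by
  obtain ⟨N, e, l, h1, h2, h3, h4, h5⟩ := h
  exact ⟨N, e, l, h1, h2, h3, h4, by rw [h5]; simp [mset3]⟩

/-- `{1^(y-1), y^c}` for an even number of tall columns. -/
theorem of_even {q r : ℕ} (hr : r % 2 = 0) (hry : r < y) :
    IsStandard x y (y - 1) 0 (q * y + r) := by
  obtain ⟨m, rfl⟩ : ∃ m, y = r + m + 1 := ⟨y - r - 1, by omega⟩
  have hlt : ∀ n, n % (r + m + 1) < r + m + 1 := fun n => Nat.mod_lt _ (by omega)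
  have h1 := GridPath.snake (x := x) (y := r + m + 1) (i := r) (m := m) (by omega) q 0
  rcases Nat.eq_zero_or_pos r with rfl | hr0
  · refine ⟨(q + 1) * (0 + m + 1) + 0, _, h1.congr ?_ (by simp [endRow]) rfl (by omega) rfl
      (by ring)⟩
    intro n
    have := hlt n
    rw [lt_succ_mul_add_iff (by omega) (by omega)]
    omega
  · obtain ⟨k, rfl⟩ : ∃ k, r = k + 1 := ⟨r - 1, by omega⟩
    have h0 := GridPath.snake (x := x) (y := k + 1 + m + 1) (i := 0) (m := k) (by omega) (q + 1) 0
    rw [endRow_of_even rfl, endRow_of_even (t := 0 + k + 1) (by omega)] at h0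
    rw [endRow_of_even rfl] at h1
    refine ⟨(q + 1) * (k + 1 + m + 1) + (k + 1), _, (h0.append_one h1 (U := fun n => _ < _)
      (by omega) ?_ ?_).congr (fun n => Iff.rfl) (by simp) rfl (by omega) rfl (by ring)⟩
    · intro n
      have := hlt n
      rw [lt_succ_mul_add_iff (by omega) (by omega)]
      omega
    · intro n
      omega

/-- `{1^(y-1), y^c}` for an odd number `r` of tall columns. -/
theorem of_odd {q r : ℕ} (hr : r % 2 = 1) (hry : r < y) (h : q = 0 ∨ r = 1 ∨ y % 2 = 0) :
    IsStandard x y (y - 1) 0 (q * y + r) := by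
  have hlt : ∀ n, n % y < y := fun n => Nat.mod_lt _ (by omega)
  have h0 := GridPath.wrap (x := x) (by omega : 1 ≤ r) hry q
  rcases eq_or_ne r 1 with rfl | hr1
  · refine ⟨(q + 1) * y + 1, _, h0.congr ?_ rfl rfl rfl rfl ?_⟩
    · intro n
      have := hlt n
      rw [lt_succ_mul_add_iff (by omega) (by omega)]
      omega
    · obtain ⟨k, rfl⟩ : ∃ k, y = k + 1 := ⟨y - 1, by omega⟩
      rw [Nat.add_sub_cancel]
      ring
  · have he : endRow q (y - r + 1) = 0 := by
      rcases h with rfl | h | h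
      · simp [endRow]
      · omega
      · exact endRow_of_even (by omega)
    rw [he] at h0
    obtain ⟨k, rfl⟩ : ∃ k, r = 1 + k + 1 := ⟨r - 2, by omega⟩
    obtain ⟨m, rfl⟩ : ∃ m, y = 1 + k + 1 + m := ⟨y - (1 + k + 1), by omega⟩
    have h1 := GridPath.snake_left (x := x) (y := 1 + k + 1 + m) (i := 1) (m := k)
      (by omega) (q + 1) 0
    rw [endRow_of_even rfl] at h1
    refine ⟨(q + 1) * (1 + k + 1 + m) + (1 + k + 1), _, (h0.append_one h1 (U := fun n => _ < _)
      (by omega) ?_ ?_).congr (fun n => Iff.rfl) rfl rfl (by omega) rfl ?_⟩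
    · intro n
      have := hlt n
      rw [lt_succ_mul_add_iff (by omega) (by omega)]
      omega
    · intro n
      omega
    · rw [Nat.add_sub_cancel_left]
      ring

/-- `{1^y, y^c}` when `y` and `c % y` are odd. -/
theorem of_odd_odd {q r : ℕ} (hr : r % 2 = 1) (hr3 : 3 ≤ r) (hry : r < y) (hy : y % 2 = 1) :
    IsStandard x y y 0 (q * y + r) := by
  have hlt : ∀ n, n % y < y := fun n => Nat.mod_lt _ (by omega)
  have h0 := GridPath.wrap (x := x) (by omega : 1 ≤ r + 1) (by omega : r + 1 < y) q
  obtain ⟨k, rfl⟩ : ∃ k, r = 3 + k := ⟨r - 3, by omega⟩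
  obtain ⟨m, rfl⟩ : ∃ m, y = 3 + k + 1 + m := ⟨y - (3 + k + 1), by omega⟩
  have h1 := GridPath.snake_left (x := x) (y := 3 + k + 1 + m) (i := 3) (m := k)
    (by omega) (q + 1) 0
  have h2 := GridPath.hook (x := x) (y := 3 + k + 1 + m) (u := 2) (w := 1)
    (by omega) (by omega) (by omega) q
  rw [endRow_of_even (by omega)] at h0
  rw [endRow_of_even rfl, endRow_of_odd (by omega)] at h1
  refine ⟨(q + 1) * (3 + k + 1 + m) + (3 + k + 1), _,
    ((h0.append_one h1 (U := fun n =>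
        ((n % (3 + k + 1 + m) = 0 ∨ 3 ≤ n % (3 + k + 1 + m) ∧ n % (3 + k + 1 + m) ≤ 3 + k) ∧
          n / (3 + k + 1 + m) ≤ q + 1) ∨
        (3 + k + 1 ≤ n % (3 + k + 1 + m) ∧ n / (3 + k + 1 + m) ≤ q))
      (by omega) ?_ ?_).append_one h2 (U := fun n => _ < _)
    (by omega) ?_ ?_).congr (fun n => Iff.rfl) rfl rfl (by omega) rfl ?_⟩
  · intro n
    omega
  · intro n
    omega
  · intro n
    have := hlt n
    rw [lt_succ_mul_add_iff (by omega) (by omega)]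
    omega
  · intro n
    omega
  · rw [Nat.add_sub_cancel_left]
    ring

/-- `{1^(y-1), x, y^c}` when `x`, `y` and `c % y ≤ x` are odd. -/
theorem one_edge_of_le {q r : ℕ} (hr : r % 2 = 1) (hr3 : 3 ≤ r) (hx : x % 2 = 1)
    (hrx : r ≤ x) (hxy : x < y) (hy : y % 2 = 1) :
    IsStandard x y (y - 1) 1 (q * y + r) := by
  have hlt : ∀ n, n % y < y := fun n => Nat.mod_lt _ (by omega)
  have h0 := GridPath.wrap (x := x) (by omega : 1 ≤ x + 1) (by omega : x + 1 < y) q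
  obtain ⟨k, rfl⟩ : ∃ k, r = 1 + k + 1 := ⟨r - 2, by omega⟩
  obtain ⟨m, rfl⟩ : ∃ m, x = 1 + k + 1 + m := ⟨x - (1 + k + 1), by omega⟩
  obtain ⟨j, rfl⟩ : ∃ j, y = 1 + k + 1 + m + 1 + j + 1 :=
    ⟨y - (1 + k + 1 + m + 1) - 1, by omega⟩
  set x := 1 + k + 1 + m with hxdef
  set y := x + 1 + j + 1 with hydef
  have h1 := GridPath.snake (x := x) (y := y) (i := 1) (m := k) (by omega) (q + 1) 0
  have h2 := GridPath.snake (x := x) (y := y) (i := 1 + k + 1) (m := m) (by omega) q 0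
  rw [endRow_of_even (by omega)] at h0
  rw [endRow_of_even rfl, endRow_of_even (by omega)] at h1
  rw [endRow_of_even rfl] at h2
  have h : IsStandard x y (y - 2) 1 (q * y + (1 + k + 1)) := by
    refine ⟨(q + 1) * y + (1 + k + 1), _,
      ((h0.append_fst (by omega) h1 (U := fun n =>
          ((n % y < 1 + k + 1) ∧ n / y ≤ q + 1) ∨ (x + 1 ≤ n % y ∧ n / y ≤ q))
        (by omega) ?_ ?_).append_one h2 (U := fun n => _ < _)
      (by omega) ?_ ?_).congr (fun n => Iff.rfl) rfl rfl (by omega) rfl ?_⟩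
    · intro n
      omega
    · intro n
      omega
    · intro n
      have := hlt n
      rw [lt_succ_mul_add_iff (by omega) (by omega)]
      omega
    · intro n
      omega
    · rw [show y - (x + 1) = j + 1 by omega, hydef, hxdef]
      ring
  have := h.add_ones 1
  rwa [show y - 2 + 1 = y - 1 by omega] at this

/-- `{1^(y-1), x, y^c}` when `x`, `y` and `c % y > x` are odd. -/
theorem one_edge_of_lt {q r : ℕ} (hr : r % 2 = 1) (hx : x % 2 = 1) (hx1 : 1 < x)
    (hrx : x < r) (hry : r < y) (hy : y % 2 = 1) :
    IsStandard x y (y - 1) 1 (q * y + r) := by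
  have hlt : ∀ n, n % y < y := fun n => Nat.mod_lt _ (by omega)
  have h0 := GridPath.wrap (x := x) (by omega : 1 ≤ r + 1) (by omega : r + 1 < y) q
  obtain ⟨k, rfl⟩ : ∃ k, x = 1 + k + 2 := ⟨x - 3, by omega⟩
  obtain ⟨m, rfl⟩ : ∃ m, r = 1 + k + 2 + 1 + m := ⟨r - (1 + k + 2 + 1), by omega⟩
  obtain ⟨j, rfl⟩ : ∃ j, y = 1 + k + 2 + 1 + m + 1 + j := ⟨y - (1 + k + 2 + 1 + m + 1), by omega⟩
  set x := 1 + k + 2 with hxdef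
  set r := x + 1 + m with hrdef
  set y := r + 1 + j with hydef
  have h1 := GridPath.snake_left (x := x) (y := y) (i := x + 1) (m := m) (by omega) (q + 1) 0
  have h2 := GridPath.snake (x := x) (y := y) (i := 1) (m := k) (by omega) (q + 1) 0
  have h3 := GridPath.hook (x := x) (y := y) (u := 1 + k + 1) (w := 1 + k + 2)
    (by omega) (by omega) (by omega) q
  rw [endRow_of_even (by omega)] at h0
  rw [endRow_of_even rfl, endRow_of_even (by omega)] at h1
  rw [endRow_of_even rfl, endRow_of_odd (by omega)] at h2
  refine ⟨(q + 1) * y + (r + 1), _,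
    (((h0.append_one h1 (U := fun n =>
        ((n % y = 0 ∨ x + 1 ≤ n % y ∧ n % y ≤ r) ∧ n / y ≤ q + 1) ∨
          (r + 1 ≤ n % y ∧ n / y ≤ q))
      (by omega) ?_ ?_).append_fst (by omega) h2 (U := fun n =>
        ((n % y ≤ 1 + k ∨ x + 1 ≤ n % y ∧ n % y ≤ r) ∧ n / y ≤ q + 1) ∨
          (r + 1 ≤ n % y ∧ n / y ≤ q))
      (by omega) ?_ ?_).append_one h3 (U := fun n => _ < _)
    (by omega) ?_ ?_).congr (fun n => Iff.rfl) rfl rfl (by omega) rfl ?_⟩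
  · intro n
    omega
  · intro n
    omega
  · intro n
    omega
  · intro n
    omega
  · intro n
    have := hlt n
    rw [lt_succ_mul_add_iff (by omega) (by omega)]
    omega
  · intro n
    omega
  · rw [show y - (r + 1) = j by omega, hydef, hrdef, hxdef]
    ring

/-- Either `{1^(y-1), y^c}` is standard, or `y` and `c % y ≥ 3` are odd. -/
theorem or_odd (x : ℕ) {y : ℕ} (hy : 0 < y) (c : ℕ) : IsStandard x y (y - 1) 0 c ∨
    (y % 2 = 1 ∧ c % y % 2 = 1 ∧ 3 ≤ c % y) := by
  have hc := Nat.div_add_mod' c y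
  have hlt := Nat.mod_lt c hy
  rcases Nat.mod_two_eq_zero_or_one (c % y) with hr | hr
  · left
    rw [← hc]
    exact of_even hr hlt
  · by_cases h : c % y = 1 ∨ y % 2 = 0
    · left
      rw [← hc]
      exact of_odd hr hlt (Or.inr h)
    · right
      omega

theorem self (x : ℕ) {y : ℕ} (hy : 0 < y) (c : ℕ) : IsStandard x y y 0 c := by
  rcases or_odd x hy c with h | ⟨h1, h2, h3⟩
  · have := h.add_ones 1
    rwa [Nat.sub_add_cancel hy] at this
  · rw [← Nat.div_add_mod' c y]
    exact of_odd_odd h2 h3 (Nat.mod_lt c hy) h1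

end IsStandard

/-- If `1 < x < y` and `a ≥ x + y - 1`, then `{1^a, x^b, y^c}`
has a linear realization. -/
theorem stmt0 (x y a b c : ℕ) (hx : 1 < x) (hxy : x < y) (ha : x + y - 1 ≤ a) :
    HasLinearRealization (mset3 a b c x y) := by
  have hx0 : 0 < x := by omega
  have hy0 : 0 < y := by omega
  have key : ∀ {a₁ a₂ b₁ b₂ : ℕ}, IsStandard x y a₁ b₁ 0 → IsStandard x y a₂ b₂ c →
      a₁ + a₂ ≤ a → b₁ + b₂ = b → HasLinearRealization (mset3 a b c x y) := by
    rintro a₁ a₂ b₁ b₂ h₁ h₂ hle rfl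
    have := (h₁.add_ones (a - (a₁ + a₂))).hasLinearRealization_add h₂
    rwa [show a₁ + (a - (a₁ + a₂)) + a₂ = a by omega, zero_add] at this
  rcases IsStandard.or_odd 1 hx0 b with h₁ | ⟨hx2, hb2, hb3⟩
  · exact key h₁.fst_of_snd (IsStandard.self x hy0 c) (by omega) (by omega)
  rcases IsStandard.or_odd x hy0 c with h₂ | ⟨hy2, hc2, hc3⟩
  · exact key (IsStandard.self 1 hx0 b).fst_of_snd h₂ (by omega) (by omega)
  have hb : IsStandard 1 x (x - 1) 0 (b / x * x + (b % x - 1)) :=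
    IsStandard.of_even (by omega) (by have := Nat.mod_lt b hx0; omega)
  have hbx := Nat.div_add_mod' b x
  have hc : IsStandard x y (y - 1) 1 c := by
    rw [← Nat.div_add_mod' c y]
    rcases le_or_gt (c % y) x with h | h
    · exact IsStandard.one_edge_of_le hc2 hc3 hx2 h hxy hy2
    · exact IsStandard.one_edge_of_lt hc2 hx2 hx h (Nat.mod_lt c hy0) hy2
  exact key hb.fst_of_snd hc (by omega) (by omega)
end

section
/- Let x, y, a, b, c be integers with 1 < x < y, b ≥ 0, c ≥ 0, where x = 3 or x is even. If a ≥ x + y − 2 then the multiset {1^a, x^b, y^c} has a linear realization. -/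
/-! ### Differences along a list -/

lemma linDiffs_cons_cons (a b : ℕ) (l : List ℕ) :
    linDiffs (a :: b :: l) = ((a - b) + (b - a)) ::ₘ linDiffs (b :: l) := rfl

lemma card_linDiffs_cons (a : ℕ) (l : List ℕ) :
    Multiset.card (linDiffs (a :: l)) = l.length := by
  simp [linDiffs]

lemma linDiffs_reverse_append (l₁ l₂ : List ℕ) (k : ℕ) :
    linDiffs (l₁.reverse ++ k :: l₂) = linDiffs (k :: l₁) + linDiffs (k :: l₂) := by
  induction l₁ generalizing k l₂ with
  | nil => simp [linDiffs]
  | cons z l₁ ih =>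
    rw [List.reverse_cons, List.append_assoc, List.singleton_append, ih, linDiffs_cons_cons,
      linDiffs_cons_cons, Nat.add_comm (z - k), Multiset.cons_add, Multiset.add_cons]

lemma linDiffs_map_add (k : ℕ) (l : List ℕ) : linDiffs (l.map (· + k)) = linDiffs l := by
  induction l with
  | nil => rfl
  | cons a l ih =>
    cases l with
    | nil => rfl
    | cons b l =>
      simp only [List.map_cons, linDiffs_cons_cons] at ih ⊢
      rw [ih, Nat.add_sub_add_right, Nat.add_sub_add_right]

lemma linDiffs_map_sub (k : ℕ) (l : List ℕ) (hl : ∀ a ∈ l, a ≤ k) :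
    linDiffs (l.map (k - ·)) = linDiffs l := by
  induction l with
  | nil => rfl
  | cons a l ih =>
    cases l with
    | nil => rfl
    | cons b l =>
      have ha := hl a (by simp)
      have hb := hl b (by simp)
      have ih' := ih fun c hc => hl c (List.mem_cons_of_mem _ hc)
      simp only [List.map_cons, linDiffs_cons_cons] at ih' ⊢
      rw [ih']
      congr 1
      omega

/-! ### Combining standard realizations -/

lemma exists_cons_of_standard {L : Multiset ℕ} (h : HasStandardLinearRealization L) :
    ∃ l : List ℕ, (0 :: l).Perm (List.range (Multiset.card L + 1)) ∧ linDiffs (0 :: l) = L := by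
  obtain ⟨l, ⟨hp, hd⟩, h0⟩ := h
  cases l with
  | nil => simp at h0
  | cons a l =>
    obtain rfl : a = 0 := by simpa using h0
    exact ⟨l, hp, hd⟩

/-- Reflect the first realization, and glue the second one to its top end. -/
lemma HasStandardLinearRealization.add {L M : Multiset ℕ} (hL : HasStandardLinearRealization L)
    (hM : HasStandardLinearRealization M) : HasLinearRealization (L + M) := by
  obtain ⟨l, hlp, hld⟩ := exists_cons_of_standard hL
  obtain ⟨m, hmp, hmd⟩ := exists_cons_of_standard hM
  set k := Multiset.card L
  have hle : ∀ a ∈ 0 :: l, a ≤ k := fun a ha => by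
    have := hlp.subset ha
    rw [List.mem_range] at this
    omega
  have hmapl : (k :: l.map (k - ·)).Perm (List.range (k + 1)) := by
    have h := hlp.map (k - ·)
    rw [List.map_cons, Nat.sub_zero] at h
    refine h.trans ?_
    have : (List.range (k + 1)).map (k - ·) = (List.range (k + 1)).reverse := by
      apply List.ext_getElem <;> simp
    rw [this]
    exact List.reverse_perm _
  have hmapm : (k :: m.map (· + k)).Perm ((List.range (Multiset.card M + 1)).map (k + ·)) := by
    have h := hmp.map (· + k)
    rw [List.map_cons, Nat.zero_add] at h
    simpa only [Nat.add_comm] using h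
  refine ⟨(l.map (k - ·)).reverse ++ k :: m.map (· + k), ?_, ?_⟩
  · have e : List.range (Multiset.card (L + M) + 1) =
        List.range k ++ (List.range (Multiset.card M + 1)).map (k + ·) := by
      rw [Multiset.card_add, Nat.add_assoc, List.range_add]
    rw [e]
    refine List.Perm.append ((List.reverse_perm _).trans ?_) hmapm
    rw [List.range_succ] at hmapl
    exact (List.perm_cons k).1 (hmapl.trans (List.perm_append_singleton k _))
  · have h1 := linDiffs_map_sub k (0 :: l) hle
    have h2 := linDiffs_map_add k (0 :: m)
    rw [List.map_cons, Nat.sub_zero] at h1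
    rw [List.map_cons, Nat.zero_add] at h2
    rw [linDiffs_reverse_append, h1, h2, hld, hmd]

lemma HasStandardLinearRealization.cons_one {L : Multiset ℕ}
    (hL : HasStandardLinearRealization L) : HasStandardLinearRealization (1 ::ₘ L) := by
  obtain ⟨l, hlp, hld⟩ := exists_cons_of_standard hL
  refine ⟨0 :: (0 :: l).map (· + 1), ⟨?_, ?_⟩, rfl⟩
  · rw [Multiset.card_cons, List.range_succ_eq_map]
    exact (hlp.map _).cons 0
  · rw [← hld, ← linDiffs_map_add 1 (0 :: l), List.map_cons, linDiffs_cons_cons]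

lemma HasStandardLinearRealization.replicate_one_add {L : Multiset ℕ}
    (hL : HasStandardLinearRealization L) (n : ℕ) :
    HasStandardLinearRealization (Multiset.replicate n 1 + L) := by
  induction n with
  | zero => simpa using hL
  | succ n ih => simpa [Multiset.replicate_succ] using ih.cons_one

/-! ### Trails with steps `1`, `x` and `y` -/

/-- `Trail x y u w S a b`: some walk leads from `u` to `w`, visits after `u` the vertices `S`
(with multiplicity), and uses `a` steps of length `1`, `b` of length `x`, and otherwise only
steps of length `y`. -/
inductive Trail (x y : ℕ) : ℕ → ℕ → Multiset ℕ → ℕ → ℕ → Prop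
  | refl (u : ℕ) : Trail x y u u 0 0 0
  | one {u z w : ℕ} {S : Multiset ℕ} {a b : ℕ} (h : u = z + 1 ∨ z = u + 1)
      (t : Trail x y z w S a b) : Trail x y u w ({z} + S) (a + 1) b
  | fst {u z w : ℕ} {S : Multiset ℕ} {a b : ℕ} (h : u = z + x ∨ z = u + x)
      (t : Trail x y z w S a b) : Trail x y u w ({z} + S) a (b + 1)
  | snd {u z w : ℕ} {S : Multiset ℕ} {a b : ℕ} (h : u = z + y ∨ z = u + y)
      (t : Trail x y z w S a b) : Trail x y u w ({z} + S) a b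

namespace Trail

variable {x y : ℕ}

lemma trans {u z w a b a' b' : ℕ} {S T : Multiset ℕ} (t : Trail x y u z S a b)
    (t' : Trail x y z w T a' b') : Trail x y u w (S + T) (a + a') (b + b') := by
  induction t with
  | refl u => simpa using t'
  | one h _ ih => rw [add_assoc, Nat.add_right_comm]; exact .one h (ih t')
  | fst h _ ih => rw [add_assoc, Nat.add_right_comm]; exact .fst h (ih t')
  | snd h _ ih => rw [add_assoc]; exact .snd h (ih t')

lemma exists_list {u w a b : ℕ} {S : Multiset ℕ} (t : Trail x y u w S a b) :
    ∃ (l : List ℕ) (c : ℕ), (l : Multiset ℕ) = S ∧ linDiffs (u :: l) = mset3 a b c x y := by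
  induction t with
  | refl u => exact ⟨[], 0, rfl, rfl⟩
  | @one u z w S a b h _ ih =>
    obtain ⟨l, c, rfl, hd⟩ := ih
    refine ⟨z :: l, c, rfl, ?_⟩
    have e : (u - z) + (z - u) = 1 := by omega
    rw [linDiffs_cons_cons, hd, e]
    simp only [mset3, Multiset.replicate_succ, Multiset.cons_add]
  | @fst u z w S a b h _ ih =>
    obtain ⟨l, c, rfl, hd⟩ := ih
    refine ⟨z :: l, c, rfl, ?_⟩
    have e : (u - z) + (z - u) = x := by omega
    rw [linDiffs_cons_cons, hd, e]
    simp only [mset3, Multiset.replicate_succ, Multiset.cons_add, Multiset.add_cons]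
  | @snd u z w S a b h _ ih =>
    obtain ⟨l, c, rfl, hd⟩ := ih
    refine ⟨z :: l, c + 1, rfl, ?_⟩
    have e : (u - z) + (z - u) = y := by omega
    rw [linDiffs_cons_cons, hd, e]
    simp only [mset3, Multiset.replicate_succ, Multiset.add_cons]

lemma hasStandard {w a a' b b' c : ℕ} {S : Multiset ℕ} (t : Trail x y 0 w S a' b')
    (ha : a' = a) (hb : b' = b) (hS : {0} + S = Multiset.range (a + b + c + 1)) :
    HasStandardLinearRealization (mset3 a b c x y) := by
  subst ha hb
  obtain ⟨l, c', rfl, hd⟩ := t.exists_list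
  have hcard : l.length + 1 = a' + b' + c + 1 := by
    simpa [add_comm] using congrArg Multiset.card hS
  obtain rfl : c' = c := by
    have h := card_linDiffs_cons 0 l
    simp only [hd, mset3, Multiset.card_add, Multiset.card_replicate] at h
    omega
  refine ⟨0 :: l, ⟨?_, hd⟩, rfl⟩
  have hv : Multiset.card (mset3 a' b' c' x y) = a' + b' + c' := by simp [mset3]
  rw [← Multiset.coe_eq_coe, hv, ← Multiset.cons_coe, ← Multiset.singleton_add, hS]
  rfl

end Trail

/-! ### Columns of vertices congruent modulo `y` -/

/-- The lowest `n` vertices `j, j + y, j + 2 * y, …` above `j` of its residue class. -/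
def col (y j n : ℕ) : Multiset ℕ := (Multiset.range n).map fun k => j + y * k

/-- The union of the columns of height `n` over `j, …, k - 1`. -/
def block (y n j k : ℕ) : Multiset ℕ := ∑ i ∈ Finset.Ico j k, col y i n

lemma col_zero (y j : ℕ) : col y j 0 = 0 := rfl

lemma col_succ (y j n : ℕ) : col y j (n + 1) = {j + y * n} + col y j n := by
  simp [col, Multiset.range_succ]

lemma col_succ' (y j n : ℕ) : col y j (n + 1) = {j} + col y (j + y) n := by
  induction n with
  | zero => simp [col]
  | succ n ih =>
    rw [col_succ, ih, col_succ, add_left_comm]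
    congr 3
    ring

lemma singleton_zero_add_col (y n : ℕ) : {0} + col y y n = col y 0 (n + 1) := by
  rw [col_succ', zero_add]

lemma block_self (y n j : ℕ) : block y n j j = 0 := by simp [block]

lemma block_add {i j k : ℕ} (y n : ℕ) (hij : i ≤ j) (hjk : j ≤ k) :
    block y n i j + block y n j k = block y n i k :=
  Finset.sum_Ico_consecutive _ hij hjk

lemma block_eq_col_add (y n : ℕ) {j k : ℕ} (h : j < k) :
    block y n j k = col y j n + block y n (j + 1) k :=
  Finset.sum_eq_sum_Ico_succ_bot h _

lemma block_succ_right (y n : ℕ) {j k : ℕ} (h : j ≤ k) :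
    block y n j (k + 1) = block y n j k + col y k n :=
  Finset.sum_Ico_succ_top h _

lemma range_add_eq (m k : ℕ) :
    Multiset.range (m + k) = Multiset.range m + ∑ i ∈ Finset.range k, {m + i} := by
  induction k with
  | zero => simp
  | succ k ih =>
    rw [← add_assoc, Multiset.range_succ, ih, Finset.sum_range_succ, ← Multiset.singleton_add]
    abel

lemma block_full (y n : ℕ) : block y n 0 y = Multiset.range (y * n) := by
  induction n with
  | zero => simp [block, col_zero]
  | succ n ih =>
    rw [Nat.mul_succ, range_add_eq, ← ih, block, block, ← Finset.range_eq_Ico,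
      ← Finset.sum_add_distrib]
    refine Finset.sum_congr rfl fun i _ => ?_
    rw [col_succ, add_comm (y * n), add_comm]

/-- `r` columns of height `n + 1` followed by columns of height `n` fill an interval. -/
lemma block_add_block {y n r : ℕ} (hr : r ≤ y) :
    block y (n + 1) 0 r + block y n r y = Multiset.range (y * n + r) := by
  have h : block y (n + 1) 0 r = block y n 0 r + ∑ i ∈ Finset.range r, {y * n + i} := by
    rw [block, block, ← Finset.range_eq_Ico, ← Finset.sum_add_distrib]
    refine Finset.sum_congr rfl fun i _ => ?_
    rw [col_succ, add_comm (y * n), add_comm]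
  rw [h, add_right_comm, block_add y n (Nat.zero_le r) hr, block_full, range_add_eq]

namespace Trail

variable {x y : ℕ}

lemma up (x y j n : ℕ) : Trail x y j (j + y * n) (col y (j + y) n) 0 0 := by
  induction n generalizing j with
  | zero => exact .refl j
  | succ n ih =>
    rw [col_succ', Nat.mul_succ, Nat.add_comm (y * n), ← Nat.add_assoc]
    exact .snd (.inr rfl) (ih _)

lemma up_zero (x y n : ℕ) : Trail x y 0 (y * n) (col y y n) 0 0 := by
  simpa only [zero_add] using up x y 0 n

lemma down (x y j n : ℕ) : Trail x y (j + y * n) j (col y j n) 0 0 := by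
  induction n with
  | zero => exact .refl j
  | succ n ih =>
    rw [col_succ]
    exact .snd (.inl (by ring)) ih

lemma one_up {u j : ℕ} (x y n : ℕ) (h : u = j + 1 ∨ j = u + 1) :
    Trail x y u (j + y * n) (col y j (n + 1)) 1 0 := by
  rw [col_succ']
  exact .one h (up x y j n)

lemma one_down {u j : ℕ} (x y n : ℕ) (h : u = j + y * n + 1 ∨ j + y * n = u + 1) :
    Trail x y u j (col y j (n + 1)) 1 0 := by
  rw [col_succ]
  exact .one h (down x y j n)

/-- Traverse columns in pairs, starting from the bottom of the column to their left. -/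
lemma right_bottom {j k t : ℕ} (x y n : ℕ) (hk : k = j + 2 * t) :
    Trail x y j k (block y (n + 1) (j + 1) (k + 1)) (2 * t) 0 := by
  subst hk
  induction t with
  | zero => rw [block_self]; exact .refl j
  | succ t ih =>
    have h := (ih.trans (one_up (j := j + 2 * t + 1) x y n (.inr rfl))).trans
      (one_down (j := j + 2 * t + 2) x y n (.inr (by ring)))
    rw [← block_succ_right _ _ (by omega), ← block_succ_right _ _ (by omega)] at h
    exact h

/-- Traverse columns in pairs, starting from the top of the column to their left. -/
lemma right_top {j k t : ℕ} (x y n : ℕ) (hk : k = j + 2 * t) :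
    Trail x y (j + y * n) (k + y * n) (block y (n + 1) (j + 1) (k + 1)) (2 * t) 0 := by
  subst hk
  induction t with
  | zero => rw [block_self]; exact .refl _
  | succ t ih =>
    have h := (ih.trans (one_down (j := j + 2 * t + 1) x y n (.inr (by ring)))).trans
      (one_up (j := j + 2 * t + 2) x y n (.inr rfl))
    rw [← block_succ_right _ _ (by omega), ← block_succ_right _ _ (by omega)] at h
    exact h

/-- Traverse columns in pairs, starting from the bottom of the column to their right. -/
lemma left_bottom {j k t : ℕ} (x y n : ℕ) (hk : k = j + 2 * t) :
    Trail x y k j (block y (n + 1) j k) (2 * t) 0 := by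
  subst hk
  induction t generalizing j with
  | zero => rw [Nat.mul_zero, Nat.add_zero, block_self]; exact .refl j
  | succ t ih =>
    have h := ((ih (j := j + 2)).trans (one_up (j := j + 1) x y n (.inl rfl))).trans
      (one_down (j := j) x y n (.inl (by ring)))
    have e : block y (n + 1) j (j + 2 + 2 * t) =
        block y (n + 1) (j + 2) (j + 2 + 2 * t) + col y (j + 1) (n + 1) + col y j (n + 1) := by
      rw [block_eq_col_add _ _ (by omega), block_eq_col_add _ _ (by omega)]
      abel
    rwa [show j + 2 * (t + 1) = j + 2 + 2 * t by ring, e]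

/-- Traverse columns in pairs, starting from the top of the column to their right. -/
lemma left_top {u j k t : ℕ} (x y n : ℕ) (hk : k = j + 2 * t) (hu : u = k + y * n) :
    Trail x y u (j + y * n) (block y (n + 1) j k) (2 * t) 0 := by
  subst hk hu
  induction t generalizing j with
  | zero => rw [Nat.mul_zero, Nat.add_zero, block_self]; exact .refl _
  | succ t ih =>
    have h := ((ih (j := j + 2)).trans (one_down (j := j + 1) x y n (.inl (by ring)))).trans
      (one_up (j := j) x y n (.inl rfl))
    have e : block y (n + 1) j (j + 2 + 2 * t) =
        block y (n + 1) (j + 2) (j + 2 + 2 * t) + col y (j + 1) (n + 1) + col y j (n + 1) := by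
      rw [block_eq_col_add _ _ (by omega), block_eq_col_add _ _ (by omega)]
      abel
    rwa [show j + 2 * (t + 1) = j + 2 + 2 * t by ring, e]

end Trail

/-! ### Standard realizations with a single long length -/

lemma standard_of_dvd (z y q : ℕ) (hy : 2 ≤ y) :
    HasStandardLinearRealization (mset3 (y - 1) 0 (y * q) z y) := by
  have hv : y - 1 + 0 + y * q + 1 = y * (q + 1) := by rw [Nat.mul_succ]; omega
  have h0 := block_eq_col_add y (q + 1) (show 0 < y by omega)
  have hu : Trail z y 0 (0 + y * q) (col y y q) 0 0 := by
    simpa only [zero_add] using Trail.up_zero z y q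
  obtain ⟨t, ht | ht⟩ : ∃ t, y = 2 * t + 1 ∨ y = 2 * t + 2 := ⟨(y - 1) / 2, by omega⟩
  · refine (hu.trans (Trail.right_top z y q (Nat.zero_add (2 * t)).symm)).hasStandard
      (by omega) rfl ?_
    rw [hv, ← block_full, h0, ← singleton_zero_add_col, add_assoc, ← ht]
  · have h1 := block_succ_right y (q + 1) (show 1 ≤ 2 * t + 1 by omega)
    refine ((hu.trans (Trail.right_top z y q (Nat.zero_add (2 * t)).symm)).trans
      (Trail.one_down (j := 2 * t + 1) z y q (.inr (by ring)))).hasStandard (by omega) rfl ?_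
    rw [show 2 * t + 1 + 1 = y by omega] at h1
    rw [hv, ← block_full, h0, ← singleton_zero_add_col, h1]
    abel

lemma standard_of_even_mod (z q s : ℕ) {y : ℕ} (hy : 2 * s + 2 < y) :
    HasStandardLinearRealization (mset3 (y - 1) 0 (y * q + (2 * s + 2)) z y) := by
  have hv : y - 1 + 0 + (y * q + (2 * s + 2)) + 1 = y * (q + 1) + (2 * s + 2) := by
    rw [Nat.mul_succ]; omega
  have h0 := block_eq_col_add y (q + 2) (show 0 < 2 * s + 2 by omega)
  have h1 := block_eq_col_add y (q + 2) (show 1 < 2 * s + 2 by omega)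
  have h := ((Trail.up_zero z y (q + 1)).trans
      (Trail.one_down (j := 1) z y (q + 1) (.inr (by ring)))).trans
      (Trail.right_bottom z y (q + 1) (Nat.add_comm (2 * s) 1))
  obtain ⟨t, ht | ht⟩ : ∃ t, y = 2 * s + 1 + 2 * t + 1 ∨ y = 2 * s + 1 + 2 * t + 2 :=
    ⟨(y - 2 * s - 2) / 2, by omega⟩
  · refine (h.trans (Trail.right_bottom (t := t) z y q rfl)).hasStandard (by omega) rfl ?_
    rw [hv, ← block_add_block hy.le, h0, h1, ← singleton_zero_add_col, ← ht]
    abel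
  · have h2 := block_succ_right y (q + 1) (show 2 * s + 2 ≤ 2 * s + 1 + 2 * t + 1 by omega)
    refine ((h.trans (Trail.right_bottom z y q rfl)).trans
      (Trail.one_up (j := 2 * s + 1 + 2 * t + 1) z y q (.inr rfl))).hasStandard
      (by omega) rfl ?_
    rw [show 2 * s + 1 + 2 * t + 1 + 1 = y by omega] at h2
    rw [hv, ← block_add_block hy.le, h0, h1, h2, ← singleton_zero_add_col]
    abel

lemma standard_of_odd_mod_of_even (z q s t : ℕ) {y : ℕ} (hy : y = 2 * s + 2 + 2 * t) :
    HasStandardLinearRealization (mset3 (y - 1) 0 (y * q + (2 * s + 1)) z y) := by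
  have hv : y - 1 + 0 + (y * q + (2 * s + 1)) + 1 = y * (q + 1) + (2 * s + 1) := by
    rw [Nat.mul_succ]; omega
  have h0 := block_eq_col_add y (q + 2) (show 0 < 2 * s + 1 by omega)
  have h1 := block_eq_col_add y (q + 1) (show 2 * s + 1 < y by omega)
  refine ((((Trail.up_zero z y (q + 1)).trans (Trail.left_top z y q hy (by ring))).trans
      (Trail.one_down (j := 2 * s + 1) z y q (.inl (by ring)))).trans
      (Trail.left_bottom z y (q + 1) (Nat.add_comm (2 * s) 1))).hasStandard (by omega) rfl ?_
  rw [hv, ← block_add_block (by omega), h0, h1, ← singleton_zero_add_col]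
  abel

lemma standard_of_mod_eq_one (z q t : ℕ) {y : ℕ} (hy : y = 1 + 2 * t) :
    HasStandardLinearRealization (mset3 (y - 1) 0 (y * q + 1) z y) := by
  have hv : y - 1 + 0 + (y * q + 1) + 1 = y * (q + 1) + 1 := by rw [Nat.mul_succ]; omega
  have h0 := block_eq_col_add y (q + 2) (show 0 < 1 by omega)
  refine ((Trail.up_zero z y (q + 1)).trans (Trail.left_top z y q hy (by ring))).hasStandard
    (by omega) rfl ?_
  rw [hv, ← block_add_block (by omega), h0, ← singleton_zero_add_col, block_self]
  abel

lemma standard_of_odd_of_lt (z s t : ℕ) {y : ℕ} (hy : y = 2 * s + 1 + 2 * t) :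
    HasStandardLinearRealization (mset3 (y - 1) 0 (2 * s + 1) z y) := by
  have hv : y - 1 + 0 + (2 * s + 1) + 1 = y * (0 + 1) + (2 * s + 1) := by omega
  have h0 := block_eq_col_add y 2 (show 0 < 2 * s + 1 by omega)
  refine (((Trail.up_zero z y 1).trans (Trail.left_top z y 0 hy (by ring))).trans
      (Trail.left_bottom z y 1 (Nat.add_comm (2 * s) 1))).hasStandard (by omega) rfl ?_
  rw [hv, ← block_add_block (by omega), h0, ← singleton_zero_add_col]
  abel

/-- An `x`-step leads from column `y + 1 - x` to the top of column `1`; here the former is one of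
the higher columns. -/
lemma standard_of_odd_odd_lt (n i k t : ℕ) {x y r : ℕ} (hx : x = 2 * k + 2 * t + 4)
    (hr : r = 2 * i + 3 + 2 * k) (hy : y = r + 2 + 2 * t) :
    HasStandardLinearRealization (mset3 (y - 1) 1 (y * (n + 1) + r) x y) := by
  have hv : y - 1 + 1 + (y * (n + 1) + r) + 1 = y * (n + 2) + (r + 1) := by
    rw [Nat.mul_succ y (n + 1)]; omega
  have h0 := block_eq_col_add y (n + 3) (show 0 < r + 1 by omega)
  have h1 := block_eq_col_add y (n + 3) (show 1 < r + 1 by omega)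
  have h2 := block_add (k := r + 1) y (n + 3) (show 2 ≤ 2 * i + 2 by omega) (by omega)
  have h3 := block_eq_col_add y (n + 3) (show 2 * i + 2 < r + 1 by omega)
  have h4 := block_succ_right y (n + 3) (show 2 * i + 3 ≤ r by omega)
  have h5 := block_eq_col_add y (n + 2) (show r + 1 < y by omega)
  have h6 := col_succ y (2 * i + 2) (n + 2)
  have h7 := col_succ y (2 * i + 2) (n + 1)
  have h8 := col_succ y 1 (n + 2)
  have t1 := (((Trail.up_zero x y (n + 2)).trans
    (Trail.left_top x y (n + 1) hy (by ring))).trans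
    (Trail.one_down (j := r + 1) x y (n + 1) (.inl (by ring)))).trans
    (Trail.one_up (j := r) x y (n + 2) (.inl rfl))
  have t2 := t1.trans (Trail.left_top x y (n + 2) hr rfl)
  have t3 := ((Trail.down x y 1 (n + 2)).trans
    (Trail.right_bottom x y (n + 2) (Nat.add_comm (2 * i) 1))).trans
    (Trail.one_up (j := 2 * i + 2) x y n (.inr rfl))
  refine (t2.trans (.one (z := 2 * i + 2 + y * (n + 2)) (.inl (by ring))
    (.snd (z := 2 * i + 2 + y * (n + 1)) (.inl (by ring))
    (.fst (.inr (by grind)) t3)))).hasStandard (by omega) rfl ?_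
  rw [hv, ← block_add_block (by omega), h0, h1, ← h2, h3, h4, h5, h6, h7, h8,
    ← singleton_zero_add_col]
  abel

/-- As `standard_of_odd_odd_lt`, with column `y + 1 - x` one of the lower columns. -/
lemma standard_of_odd_odd_le (n i k t : ℕ) {x y r : ℕ} (hx : x = 2 * t + 2)
    (hr : r = 2 * i + 1) (hy : y = 2 * i + 2 * k + 3 + 2 * t) :
    HasStandardLinearRealization (mset3 (y - 1) 1 (y * (n + 1) + r) x y) := by
  have hv : y - 1 + 1 + (y * (n + 1) + r) + 1 = y * (n + 2) + (r + 1) := by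
    rw [Nat.mul_succ y (n + 1)]; omega
  have h0 := block_eq_col_add y (n + 3) (show 0 < r + 1 by omega)
  have h1 := block_eq_col_add y (n + 3) (show 1 < r + 1 by omega)
  have h2 := block_add (k := y) y (n + 2) (show r + 1 ≤ r + 2 * k + 1 by omega) (by omega)
  have h3 := block_eq_col_add y (n + 2) (show r + 2 * k + 1 < y by omega)
  have h6 := col_succ y (r + 2 * k + 1) (n + 1)
  have h8 := col_succ y 1 (n + 2)
  have t1 := (Trail.up_zero x y (n + 2)).trans (Trail.left_top (j := r + 2 * k + 1 + 1) (t := t)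
    x y (n + 1) (by omega) (show y * (n + 2) = y + y * (n + 1) by ring))
  have t3 := (((Trail.down x y 1 (n + 2)).trans
    (Trail.right_bottom (k := r) (t := i) x y (n + 2) (by omega))).trans
    (Trail.right_bottom (t := k) x y (n + 1) rfl)).trans
    (Trail.one_up (j := r + 2 * k + 1) x y n (.inr rfl))
  refine (t1.trans (.one (z := r + 2 * k + 1 + y * (n + 1)) (.inl (by ring))
    (.fst (.inr (by grind)) t3))).hasStandard (by omega) rfl ?_
  rw [hv, ← block_add_block (by omega), h0, h1, ← h2, h3, h6, h8, ← singleton_zero_add_col]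
  abel

/-- Both orders of the columns `1` and `3` are allowed, depending on the step leaving `4`. -/
lemma standard_of_jump (q i t : ℕ) {x y r p p' a b : ℕ} (hr : r = 2 * i + 3)
    (hy : y = r + 2 + 2 * t) (hp : p = 1 ∧ p' = 3 ∨ p = 3 ∧ p' = 1) (hab : a + b = 1)
    (e : Trail x y 4 p {p} a b) :
    HasStandardLinearRealization (mset3 (y - 1 + a) b (y * q + r) x y) := by
  have hv : y - 1 + a + b + (y * q + r) + 1 = y * (q + 1) + (r + 1) := by
    rw [Nat.mul_succ]; omega
  have h0 := block_eq_col_add y (q + 2) (show 0 < r + 1 by omega)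
  have h1 := block_eq_col_add y (q + 2) (show 1 < r + 1 by omega)
  have h2 := block_eq_col_add y (q + 2) (show 2 < r + 1 by omega)
  have h3 := block_eq_col_add y (q + 2) (show 3 < r + 1 by omega)
  have h4 := block_eq_col_add y (q + 1) (show r + 1 < y by omega)
  have h5 := col_succ y 2 (q + 1)
  have h6 : {p} + (col y (p + y) (q + 1) + col y p' (q + 2)) =
      col y 1 (q + 2) + col y 3 (q + 2) := by
    rw [← add_assoc, ← col_succ']
    obtain ⟨rfl, rfl⟩ | ⟨rfl, rfl⟩ := hp
    exacts [rfl, add_comm _ _]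
  have t1 := (((Trail.up_zero x y (q + 1)).trans
    (Trail.left_top x y q hy (by ring))).trans
    (Trail.one_down (j := r + 1) x y q (.inl (by ring)))).trans
    (Trail.left_bottom (j := 4) (t := i) x y (q + 1) (by omega))
  have t2 := (Trail.one_down (u := 2 + y * (q + 1)) (j := p') x y (q + 1) (by omega)).trans
    (Trail.one_up (j := 2) x y q (by omega))
  refine (((t1.trans e).trans (Trail.up x y p (q + 1))).trans
    (.one (z := 2 + y * (q + 1)) (by omega) t2)).hasStandard (by omega) (by omega) ?_
  rw [hv, ← block_add_block (by omega), h0, h1, h2, h3, h4, h5, ← singleton_zero_add_col]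
  calc _ = {0} + col y y (q + 1) + ({p} + (col y (p + y) (q + 1) + col y p' (q + 2))) +
      ({2 + y * (q + 1)} + col y 2 (q + 1)) + block y (q + 2) 4 (r + 1) +
      (col y (r + 1) (q + 1) + block y (q + 1) (r + 1 + 1) y) := by abel
    _ = _ := by rw [h6]; abel

/-! ### The main cases -/

lemma standard_of_omega_eq_pred {y c : ℕ} (z : ℕ) (hy : 2 ≤ y)
    (h : c / y = 0 ∨ c % y = 1 ∨ Even y ∨ Even (c % y)) :
    HasStandardLinearRealization (mset3 (y - 1) 0 c z y) := by
  have hlt := Nat.mod_lt c (show 0 < y by omega)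
  have hc := Nat.div_add_mod c y
  generalize c / y = q at *
  generalize c % y = r at *
  subst hc
  obtain ⟨s, rfl | rfl⟩ := r.even_or_odd'
  · cases s with
    | zero => exact standard_of_dvd z y q hy
    | succ s => exact standard_of_even_mod z q s hlt
  · have hr : ¬ Even (2 * s + 1) := by simp
    obtain ⟨k, rfl | rfl⟩ := y.even_or_odd'
    · exact standard_of_odd_mod_of_even z q s (k - s - 1) (by omega)
    · have hy' : ¬ Even (2 * k + 1) := by simp
      obtain rfl | hs := show q = 0 ∨ s = 0 by grind
      · rw [Nat.mul_zero, Nat.zero_add]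
        exact standard_of_odd_of_lt z s (k - s) (by omega)
      · subst hs
        exact standard_of_mod_eq_one z q k (by omega)

lemma exists_odd_parameters {y c : ℕ} (h : ¬ (c / y = 0 ∨ c % y = 1 ∨ Even y ∨ Even (c % y))) :
    ∃ i t, c % y = 2 * i + 3 ∧ y = c % y + 2 + 2 * t := by
  simp only [not_or, Nat.not_even_iff_odd] at h
  obtain ⟨h0, h1, ⟨k, hk⟩, ⟨s, hs⟩⟩ := h
  have := Nat.mod_lt c (show 0 < y by omega)
  exact ⟨s - 1, k - s - 1, by omega, by omega⟩

/-- The remaining residues cost one additional `1`. -/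
lemma standard_with_extra_one {y c : ℕ} (z : ℕ)
    (h : ¬ (c / y = 0 ∨ c % y = 1 ∨ Even y ∨ Even (c % y))) :
    HasStandardLinearRealization (mset3 y 0 c z y) := by
  obtain ⟨i, t, hr, hy⟩ := exists_odd_parameters h
  have key := standard_of_jump (x := z) (c / y) i t hr hy (.inr ⟨rfl, rfl⟩) rfl
    (.one (.inl rfl) (.refl 3))
  rwa [Nat.div_add_mod, show y - 1 + 1 = y by omega] at key

/-- The remaining residues cost one step of length `x` instead. -/
lemma standard_with_one_fst {x y c : ℕ} (hx : 1 < x) (hxy : x < y) (hx' : x = 3 ∨ Even x)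
    (h : ¬ (c / y = 0 ∨ c % y = 1 ∨ Even y ∨ Even (c % y))) :
    HasStandardLinearRealization (mset3 (y - 1) 1 c x y) := by
  obtain ⟨i, t, hr, hy⟩ := exists_odd_parameters h
  obtain ⟨n, hn⟩ : ∃ n, c / y = n + 1 := Nat.exists_eq_succ_of_ne_zero fun h0 => h (.inl h0)
  rw [← Nat.div_add_mod c y]
  obtain rfl | ⟨k, hk⟩ := hx'
  · exact standard_of_jump (x := 3) (a := 0) (c / y) i t hr hy (.inl ⟨rfl, rfl⟩) rfl
      (.fst (z := 1) (.inl rfl) (.refl 1))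
  · rw [hn]
    obtain hlt | hle := lt_or_ge (y + 1 - x) (c % y)
    · exact standard_of_odd_odd_lt n ((y + 1 - x) / 2 - 1) (k - t - 2) t (by omega) (by omega) hy
    · exact standard_of_odd_odd_le n (i + 1) (t + 1 - k) (k - 1) (by omega) (by omega) (by omega)

/-- If `1 < x < y`, `x = 3` or `x` is even, and `a ≥ x + y - 2`,
then `{1^a, x^b, y^c}` has a linear realization. -/
theorem stmt1 (x y a b c : ℕ) (hx : 1 < x) (hxy : x < y)
    (hx' : x = 3 ∨ Even x) (ha : x + y - 2 ≤ a) :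
    HasLinearRealization (mset3 a b c x y) := by
  have hX (n : ℕ) : HasStandardLinearRealization (mset3 (x - 1) 0 n 1 x) := by
    refine standard_of_omega_eq_pred 1 hx ?_
    obtain rfl | he := hx'
    · have := Nat.mod_lt n (show 0 < 3 by omega)
      interval_cases n % 3 <;> simp
    · exact .inr (.inr (.inl he))
  by_cases h : c / y = 0 ∨ c % y = 1 ∨ Even y ∨ Even (c % y)
  · obtain ⟨d, rfl⟩ : ∃ d, a = d + (x - 1) + (y - 1) := ⟨a - (x - 1) - (y - 1), by omega⟩
    convert ((hX b).replicate_one_add d).add (standard_of_omega_eq_pred 1 (by omega) h) using 1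
    simp only [mset3, Multiset.replicate_add, Multiset.replicate_zero]
    abel
  · cases b with
    | zero =>
      obtain ⟨d, rfl⟩ : ∃ d, a = d + (x - 2) + y := ⟨a - (x - 2) - y, by omega⟩
      obtain ⟨l, hl, -⟩ := (standard_with_extra_one x h).replicate_one_add (d + (x - 2))
      refine ⟨l, ?_⟩
      convert hl using 1
      simp only [mset3, Multiset.replicate_add, Multiset.replicate_zero]
      abel
    | succ b =>
      obtain ⟨d, rfl⟩ : ∃ d, a = d + (x - 1) + (y - 1) := ⟨a - (x - 1) - (y - 1), by omega⟩
      convert ((hX b).replicate_one_add d).add (standard_with_one_fst hx hxy hx' h) using 1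
      simp only [mset3, Multiset.replicate_add, Multiset.replicate_zero]
      abel
end

section
/- Let x, y, a, b, c be integers with 1 < x < y, c ≥ 0 and c ≡ 0 or 1 (mod y). If a + b = y − 1 and a ≥ ω(x, b), then the multiset {1^a, x^b, y^c} has a standard linear realization. -/
/-- `Trail s t L S`: there is a finite sequence of integers from `s` to `t` whose consecutive
absolute differences form `L` and which visits every element of `S`. -/
inductive Trail_s6 : ℤ → ℤ → Multiset ℕ → Set ℤ → Prop
  | single {s : ℤ} {S : Set ℤ} (h : ∀ n ∈ S, n = s) : Trail_s6 s s 0 S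
  | cons {s s' t : ℤ} {d : ℕ} {L : Multiset ℕ} {S S' : Set ℤ} (hd : (s - s').natAbs = d)
      (h : Trail_s6 s' t L S) (hS : ∀ n ∈ S', n = s ∨ n ∈ S) : Trail_s6 s t ({d} + L) S'

namespace Trail_s6

variable {s t s' t' : ℤ} {L L' : Multiset ℕ} {S S' : Set ℤ}

theorem mono (h : Trail_s6 s t L S) (hS : S' ⊆ S) : Trail_s6 s t L S' := by
  cases h with
  | single h => exact .single fun n hn => h n (hS hn)
  | cons hd h h2 => exact .cons hd h fun n hn => h2 n (hS hn)

theorem congr (h : Trail_s6 s t L S) (hs : s = s') (ht : t = t') (hL : L = L') (hS : S' ⊆ S) :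
    Trail_s6 s' t' L' S' := by
  subst hs ht hL
  exact h.mono hS

theorem append {d : ℕ} (h : Trail_s6 s t L S) (hd : (t - s').natAbs = d) (h' : Trail_s6 s' t' L' S') :
    Trail_s6 s t' (L + {d} + L') (S ∪ S') := by
  induction h with
  | single h =>
    rw [zero_add]
    exact .cons hd h' fun n hn => hn.imp (h n) id
  | cons hd' _ hS ih =>
    rw [add_assoc {_}, add_assoc {_}]
    refine .cons hd' (ih hd) fun n hn => ?_
    rcases hn with hn | hn
    · exact (hS n hn).imp id Or.inl
    · exact .inr (.inr hn)

theorem reflect (h : Trail_s6 s t L S) (c : ℤ) : Trail_s6 (c - s) (c - t) L {n | c - n ∈ S} := by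
  induction h with
  | single h =>
    exact .single fun n hn => by have := h _ hn; lia
  | cons hd _ hS ih =>
    refine .cons (by lia) ih fun n hn => ?_
    exact (hS _ hn).imp (fun h => by lia) id

/-- A run of `k` unit steps upwards. -/
theorem line (s : ℤ) (k : ℕ) : Trail_s6 s (s + k) (k • {1}) {n | s ≤ n ∧ n ≤ s + k} := by
  induction k generalizing s with
  | zero => exact (Trail_s6.single (s := s) (S := {s}) (by simp)).congr rfl (by simp) (by simp)
              fun n hn => by simp at hn ⊢; lia
  | succ k ih =>
    refine (Trail_s6.cons (d := 1) (by lia) (ih (s + 1)) (S' := {n | s ≤ n ∧ n ≤ s + (k + 1 : ℕ)})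
      fun n hn => ?_).congr rfl (by push_cast; ring) (by rw [succ_nsmul']) subset_rfl
    simp at hn ⊢
    lia

/-- A run of `k` unit steps downwards. -/
theorem line_down (s : ℤ) (k : ℕ) : Trail_s6 s (s - k) (k • {1}) {n | s - k ≤ n ∧ n ≤ s} :=
  ((line (-s) k).reflect 0).congr (by ring) (by ring) rfl fun n hn => by simp at hn ⊢; lia

/-- A run of `k` steps of length `y` upwards. -/
theorem column (s : ℤ) (y k : ℕ) :
    Trail_s6 s (s + k * y) (k • {y}) {n | ∃ i : ℕ, i ≤ k ∧ n = s + i * y} := by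
  induction k generalizing s with
  | zero => exact (Trail_s6.single (s := s) (S := {s}) (by simp)).congr rfl (by simp) (by simp)
              fun n hn => by simpa using hn
  | succ k ih =>
    refine (Trail_s6.cons (d := y) (by lia) (ih (s + y))
      (S' := {n | ∃ i : ℕ, i ≤ k + 1 ∧ n = s + i * y})
      fun n hn => ?_).congr rfl (by push_cast; ring) (by rw [succ_nsmul']) subset_rfl
    obtain ⟨i, hi, rfl⟩ := hn
    rcases i with _ | i
    · simp
    · exact .inr ⟨i, by lia, by push_cast; ring⟩

/-- A run of `k` steps of length `y` downwards. -/
theorem column_down (s : ℤ) (y k : ℕ) :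
    Trail_s6 (s + k * y) s (k • {y}) {n | ∃ i : ℕ, i ≤ k ∧ n = s + i * y} := by
  refine ((column (-(s + k * y)) y k).reflect 0).congr (by ring) (by ring) rfl ?_
  rintro n ⟨i, hi, rfl⟩
  refine ⟨k - i, by lia, ?_⟩
  push_cast [hi]
  ring

/-- Replace every vertex by a column of `m` steps of length `y`, traversed alternately upwards and
downwards. The first trail starts at the bottom of a column, the second one at the top. -/
theorem zigzag (h : Trail_s6 s t L S) (y m : ℕ) :
    Trail_s6 s (t + if Even L.card then (m * y : ℤ) else 0) (L + ((L.card + 1) * m) • {y})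
      {n | ∃ j ∈ S, ∃ i : ℕ, i ≤ m ∧ n = j + i * y} ∧
    Trail_s6 (s + m * y) (t + if Even L.card then 0 else (m * y : ℤ)) (L + ((L.card + 1) * m) • {y})
      {n | ∃ j ∈ S, ∃ i : ℕ, i ≤ m ∧ n = j + i * y} := by
  induction h with
  | @single s S h =>
    have hS : {n | ∃ j ∈ S, ∃ i : ℕ, i ≤ m ∧ n = j + i * y} ⊆
        {n | ∃ i : ℕ, i ≤ m ∧ n = s + i * y} := by
      rintro n ⟨j, hj, i, hi, rfl⟩
      exact ⟨i, hi, by rw [h j hj]⟩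
    exact ⟨(column s y m).congr rfl (by simp) (by simp) hS,
      (column_down s y m).congr rfl (by simp) (by simp) hS⟩
  | @cons s s' t d L S S' hd _ hS ih =>
    have hcov : {n | ∃ j ∈ S', ∃ i : ℕ, i ≤ m ∧ n = j + i * y} ⊆
        {n : ℤ | ∃ i : ℕ, i ≤ m ∧ n = s + i * y} ∪
          {n | ∃ j ∈ S, ∃ i : ℕ, i ≤ m ∧ n = j + i * y} := by
      rintro n ⟨j, hj, i, hi, rfl⟩
      rcases hS j hj with rfl | hj
      · exact .inl ⟨i, hi, rfl⟩
      · exact .inr ⟨j, hj, i, hi, rfl⟩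
    have hL : m • {y} + {d} + (L + ((L.card + 1) * m) • {y}) =
        {d} + L + ((({d} + L : Multiset ℕ).card + 1) * m) • {y} := by
      simp only [Multiset.card_add, Multiset.card_singleton]
      module
    have hpar : Even (({d} + L : Multiset ℕ).card) ↔ ¬ Even L.card := by
      simp only [Multiset.card_add, Multiset.card_singleton]
      grind
    refine ⟨((column s y m).append (d := d) (by lia) ih.2).congr rfl ?_ hL hcov,
      ((column_down s y m).append (d := d) hd ih.1).congr rfl ?_ hL hcov⟩
    · simp only [hpar, ite_not]
    · simp only [hpar, ite_not]

theorem exists_list_s6 (h : Trail_s6 s t L S) : ∃ l : List ℤ, l.head? = some s ∧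
    l.length = L.card + 1 ∧ (∀ n ∈ S, n ∈ l) ∧
    ((∀ n ∈ l, 0 ≤ n) → linDiffs (l.map Int.toNat) = L) := by
  induction h with
  | @single s S h => exact ⟨[s], rfl, rfl, by simpa using h, fun _ => rfl⟩
  | @cons s s' t d L S S' hd _ hS ih =>
    obtain ⟨l, hh, hl, hm, hdiff⟩ := ih
    refine ⟨s :: l, rfl, by simp [hl, add_comm], fun n hn => ?_, fun hn => ?_⟩
    · exact List.mem_cons.2 ((hS n hn).imp id (hm n))
    · obtain ⟨u, rfl⟩ : ∃ u, l = s' :: u := by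
        cases l with
        | nil => simp at hh
        | cons e u => simp at hh; exact ⟨u, by rw [hh]⟩
      have h1 := hdiff fun n hn' => hn n (List.mem_cons_of_mem _ hn')
      have h2 := hn s (by simp)
      have h3 := hn s' (by simp)
      rw [← h1, Multiset.singleton_add]
      have h4 : d = (s.toNat - s'.toNat) + (s'.toNat - s.toNat) := by lia
      rw [h4]
      rfl

theorem hasStandardLinearRealization (h : Trail_s6 0 t L S)
    (hS : ∀ n : ℕ, n ≤ L.card → (n : ℤ) ∈ S) : HasStandardLinearRealization L := by
  obtain ⟨l, hh, hl, hm, hdiff⟩ := h.exists_list_s6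
  have hnd : ((List.range (L.card + 1)).map (Nat.cast : ℕ → ℤ)).Nodup :=
    List.nodup_range.map Nat.cast_injective
  have hsub : (List.range (L.card + 1)).map (Nat.cast : ℕ → ℤ) ⊆ l := by
    intro n hn
    obtain ⟨k, hk, rfl⟩ := List.mem_map.1 hn
    exact hm _ (hS k (by simpa [Nat.lt_succ_iff] using hk))
  have hperm := (List.subperm_of_subset hnd hsub).perm_of_length_le (by simp [hl])
  have hnonneg : ∀ n ∈ l, 0 ≤ n := by
    intro n hn
    obtain ⟨k, -, rfl⟩ := List.mem_map.1 (hperm.mem_iff.2 hn)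
    positivity
  refine ⟨l.map Int.toNat, ⟨?_, hdiff hnonneg⟩, by simp [List.head?_map, hh]⟩
  simpa [Function.comp_def] using (hperm.map Int.toNat).symm

/-- Prepending `0` to a shifted trail adds one unit step. -/
theorem prepend_ones {N : ℕ} (h : Trail_s6 0 t L {n | 0 ≤ n ∧ n ≤ N}) (k : ℕ) :
    ∃ t', Trail_s6 0 t' (k • {1} + L) {n | 0 ≤ n ∧ n ≤ (k + N : ℕ)} := by
  induction k with
  | zero => exact ⟨t, h.congr rfl rfl (by simp) (by simp)⟩
  | succ k ih =>
    obtain ⟨t', h'⟩ := ih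
    refine ⟨0 - (-1 - t'), (Trail_s6.cons (s := 0) (d := 1) (by lia) ((h'.reflect (-1)).reflect 0)
      (S' := {n | 0 ≤ n ∧ n ≤ (k + 1 + N : ℕ)}) fun n hn => ?_).congr rfl rfl (by module)
      subset_rfl⟩
    simp at hn ⊢
    lia

/-- The column of `0` upwards, then the columns of the reflected trail, starting at the top. -/
theorem column_append_zigzag (h : Trail_s6 0 t L S) (hL : L ≠ 0) (y k : ℕ) :
    ∃ t', Trail_s6 0 t' (L + (L.card * k + (k + 1)) • {y})
      {n | (∃ i : ℕ, i ≤ k + 1 ∧ n = i * y) ∨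
        ∃ j ∈ S, j ≠ 0 ∧ ∃ i : ℕ, i ≤ k ∧ n = y - j + i * y} := by
  cases h with
  | single => exact absurd rfl hL
  | @cons _ s' _ d L S' _ hd h hS =>
    refine ⟨_, ((column 0 y (k + 1)).append (d := d) ?_
      ((h.reflect y).zigzag y k).2).congr rfl rfl ?_ ?_⟩
    · rw [← hd]
      push_cast
      ring_nf
      lia
    · simp only [Multiset.card_add, Multiset.card_singleton]
      module
    · rintro n (⟨i, hi, rfl⟩ | ⟨j, hj, hj0, i, hi, rfl⟩)
      · exact .inl ⟨i, hi, (zero_add _).symm⟩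
      · exact .inr ⟨y - j, by simpa using (hS j hj).resolve_left hj0, i, hi, rfl⟩

end Trail_s6

theorem exists_add_mul_of_lt {x : ℕ} (q r : ℕ) (hr : r ≤ x) {n : ℤ} (h0 : 0 ≤ n)
    (hn : n < (q + 1) * x + r) :
    ∃ i j : ℕ, j < x ∧ n = j + i * x ∧ (i ≤ q ∨ i ≤ q + 1 ∧ j < r) := by
  lift n to ℕ using h0
  have hx : 0 < x := by
    rcases Nat.eq_zero_or_pos x with rfl | h
    · simp at hn; lia
    · exact h
  norm_cast at hn
  have h1 := Nat.mod_add_div n x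
  refine ⟨n / x, n % x, Nat.mod_lt _ hx, by rw [mul_comm]; exact_mod_cast h1.symm, ?_⟩
  have h2 : n / x < q + 2 := by
    rw [Nat.div_lt_iff_lt_mul hx]
    nlinarith
  rcases Nat.lt_or_ge (n / x) (q + 1) with h | h
  · exact .inl (by lia)
  · have h3 : n / x = q + 1 := by lia
    refine .inr ⟨h3.le, ?_⟩
    rw [h3] at h1
    nlinarith

/-- Columns modulo `x` traversed from left to right. -/
theorem trail_of_even {x q r : ℕ} (hr : r < x) (h : Even r) :
    ∃ t, Trail_s6 0 t ((x - 1) • {1} + (q * x + r) • {x}) {n | 0 ≤ n ∧ n < (q + 1) * x + r} := by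
  obtain ⟨k, rfl⟩ : ∃ k, x = r + 1 + k := ⟨x - r - 1, by lia⟩
  have hright := ((Trail_s6.line r k).zigzag (r + 1 + k) q).1
  rcases r with _ | r
  · refine ⟨_, hright.congr (by simp) rfl ?_ ?_⟩
    · simp only [Multiset.card_nsmul, Multiset.card_singleton]
      rw [show 0 + 1 + k - 1 = k by lia]
      module
    · rintro n ⟨h0, hn⟩
      obtain ⟨i, j, hj, rfl, hi⟩ := exists_add_mul_of_lt q 0 (by lia) h0 hn
      exact ⟨j, by simp; lia, i, by lia, by push_cast; ring⟩
  · have hleft := ((Trail_s6.line 0 r).zigzag (r + 1 + 1 + k) (q + 1)).1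
    have hodd : ¬ Even r := by grind
    simp only [Multiset.card_nsmul, Multiset.card_singleton, mul_one, hodd, if_false] at hleft
    refine ⟨_, (hleft.append (d := 1) (by push_cast; lia) hright).congr rfl rfl ?_ ?_⟩
    · simp only [Multiset.card_nsmul, Multiset.card_singleton]
      rw [show r + 1 + 1 + k - 1 = r + 1 + k by lia]
      module
    · rintro n ⟨h0, hn⟩
      obtain ⟨i, j, hj, rfl, hi⟩ := exists_add_mul_of_lt q (r + 1) (by lia) h0 hn
      rcases Nat.lt_or_ge j (r + 1) with hjr | hjr
      · exact .inl ⟨j, by simp; lia, i, by lia, rfl⟩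
      · exact .inr ⟨j, by simp; lia, i, by lia, rfl⟩

/-- The first column modulo `x`, then the other columns from right to left. -/
theorem trail_of_odd {x q r : ℕ} (hr : r < x) (hr0 : 0 < r)
    (h : q = 0 ∨ r = 1 ∨ Even (x - 1 - r)) :
    ∃ t, Trail_s6 0 t ((x - 1) • {1} + (q * x + r) • {x}) {n | 0 ≤ n ∧ n < (q + 1) * x + r} := by
  obtain ⟨k, rfl⟩ : ∃ k, x = r + 1 + k := ⟨x - r - 1, by lia⟩
  rw [show r + 1 + k - 1 - r = k by lia] at h
  rw [show r + 1 + k - 1 = r + k by lia]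
  have hfirst := Trail_s6.column 0 (r + 1 + k) (q + 1)
  have hmid := ((Trail_s6.line_down (r + k : ℕ) k).zigzag (r + 1 + k) q).2
  have hstart := hfirst.append (d := 1) (by push_cast; ring_nf; simp) hmid
  obtain ⟨r, rfl⟩ : ∃ r', r = r' + 1 := ⟨r - 1, by lia⟩
  rcases Nat.eq_zero_or_pos r with rfl | hrpos
  · refine ⟨_, hstart.congr rfl rfl ?_ ?_⟩
    · simp only [Multiset.card_nsmul, Multiset.card_singleton]
      module
    · rintro n ⟨h0, hn⟩
      obtain ⟨i, j, hj, rfl, hi⟩ := exists_add_mul_of_lt q (0 + 1) (by lia) h0 hn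
      rcases Nat.eq_zero_or_pos j with rfl | hjr
      · exact .inl ⟨i, by lia, by push_cast; ring⟩
      · exact .inr ⟨j, by simp; lia, i, by lia, rfl⟩
  · have hlast := ((Trail_s6.line_down r (r - 1)).zigzag (r + 1 + 1 + k) (q + 1)).1
    have hend : (if Even (k • {1} : Multiset ℕ).card then (0 : ℤ)
        else (q * (r + 1 + 1 + k : ℕ) : ℤ)) = 0 := by
      simp only [Multiset.card_nsmul, Multiset.card_singleton, mul_one]
      rcases h with rfl | h | h
      · simp
      · lia
      · simp [h]
    rw [hend] at hstart
    refine ⟨_, (hstart.append (d := 1) (by push_cast; lia) hlast).congr rfl rfl ?_ ?_⟩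
    · simp only [Multiset.card_nsmul, Multiset.card_singleton]
      obtain ⟨r, rfl⟩ : ∃ r', r = r' + 1 := ⟨r - 1, by lia⟩
      rw [show r + 1 - 1 = r by lia]
      module
    · rintro n ⟨h0, hn⟩
      obtain ⟨i, j, hj, rfl, hi⟩ := exists_add_mul_of_lt q (r + 1) (by lia) h0 hn
      rcases Nat.eq_zero_or_pos j with rfl | hj0
      · exact .inl (.inl ⟨i, by lia, by push_cast; ring⟩)
      rcases Nat.lt_or_ge j (r + 1) with hjr | hjr
      · exact .inr ⟨j, by simp; lia, i, by lia, rfl⟩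
      · exact .inl (.inr ⟨j, by simp; lia, i, by lia, rfl⟩)

/-- The last two columns modulo `x`, traversed with two unit steps. -/
theorem trail_last_two (x q : ℕ) :
    Trail_s6 (x + 1 + (q + 1 : ℕ) * (x + 2 : ℕ)) (x + q * (x + 2 : ℕ))
      ((q + 1) • {x + 2} + {1} + q • {x + 2})
      {n | ∃ i : ℕ, i ≤ q + 1 ∧ n = x + 1 + i * (x + 2 : ℕ) ∨
        i ≤ q ∧ n = x + i * (x + 2 : ℕ)} := by
  refine ((Trail_s6.column_down (x + 1) (x + 2) (q + 1)).append (d := 1) (by lia)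
    (Trail_s6.column x (x + 2) q)).congr rfl rfl rfl ?_
  rintro n ⟨i, hi | hi⟩
  · exact .inl ⟨i, hi⟩
  · exact .inr ⟨i, hi⟩

theorem trail_of_odd_odd {x q r : ℕ} (hr : r < x) (hx : Odd x) (ho : Odd r) :
    ∃ t, Trail_s6 0 t (x • {1} + ((q + 1) * x + r) • {x})
      {n | 0 ≤ n ∧ n < (q + 1 + 1) * x + (r + 1)} := by
  obtain ⟨x, rfl⟩ : ∃ x', x = x' + 2 := ⟨x - 2, by grind⟩
  have hend := trail_last_two x q
  rcases (by grind : r = x ∨ r + 2 ≤ x) with rfl | hrx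
  · obtain ⟨r, rfl⟩ : ∃ r', r = r' + 1 := ⟨r - 1, by grind⟩
    have heven : Even r := by grind
    have hleft := ((Trail_s6.line 0 r).zigzag (r + 1 + 2) (q + 1 + 1)).1
    simp only [Multiset.card_nsmul, Multiset.card_singleton, mul_one, heven, if_true] at hleft
    have hcorner := Trail_s6.column_down ((r + 1 : ℕ) + (q + 1 : ℕ) * (r + 1 + 2 : ℕ)) (r + 1 + 2) 1
    refine ⟨_, ((hleft.append (d := 1) (by push_cast; ring_nf; simp) hcorner).append (d := 1)
      (by push_cast; ring_nf; simp) hend).congr rfl rfl ?_ ?_⟩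
    · module
    · rintro n ⟨h0, hn⟩
      obtain ⟨i, j, hj, rfl, hi⟩ := exists_add_mul_of_lt (x := r + 1 + 2) (q + 1) (r + 1 + 1)
        (by lia) h0
        (by push_cast at hn ⊢; linarith)
      rcases (by lia : j ≤ r ∨ j = r + 1 ∨ j = r + 2) with hjr | rfl | rfl
      · exact .inl (.inl ⟨j, by simp; lia, i, by lia, rfl⟩)
      · rcases Nat.lt_or_ge q i with hiq | hiq
        · exact .inl (.inr ⟨i - (q + 1), by lia, by push_cast [Nat.succ_le_of_lt hiq]; ring⟩)
        · exact .inr ⟨i, .inr ⟨hiq, rfl⟩⟩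
      · exact .inr ⟨i, .inl ⟨by lia, by push_cast; ring⟩⟩
  · obtain ⟨k, rfl⟩ : ∃ k, x = r + 2 + k := ⟨x - r - 2, by lia⟩
    have hodd : ¬ Even r := by grind
    have heven : Even k := by grind
    have hleft := ((Trail_s6.line 0 r).zigzag (r + 2 + k + 2) (q + 1 + 1)).1
    have hmid := ((Trail_s6.line (r + 1) k).zigzag (r + 2 + k + 2) (q + 1)).1
    simp only [Multiset.card_nsmul, Multiset.card_singleton, mul_one, hodd, heven, if_true,
      if_false] at hleft hmid
    have htop := Trail_s6.single (s := (r + 2 + k : ℕ) + (q + 1 : ℕ) * (r + 2 + k + 2 : ℕ))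
      (S := {((r + 2 + k : ℕ) + (q + 1 : ℕ) * (r + 2 + k + 2 : ℕ) : ℤ)}) (by simp)
    refine ⟨_, (((hleft.append (d := 1) (by lia) hmid).append (d := 1)
      (by push_cast; ring_nf; simp) htop).append (d := 1)
      (by push_cast; ring_nf; simp) hend).congr rfl rfl ?_ ?_⟩
    · module
    · rintro n ⟨h0, hn⟩
      obtain ⟨i, j, hj, rfl, hi⟩ := exists_add_mul_of_lt (x := r + 2 + k + 2) (q + 1) (r + 1)
        (by lia) h0
        (by push_cast at hn ⊢; linarith)
      rcases (by lia : j ≤ r ∨ (r + 1 ≤ j ∧ j ≤ r + 1 + k) ∨ j = r + 2 + k ∨ j = r + 2 + k + 1)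
        with hjr | hjr | rfl | rfl
      · exact .inl (.inl (.inl ⟨j, by simp; lia, i, by lia, rfl⟩))
      · exact .inl (.inl (.inr ⟨j, by simp; lia, i, by lia, rfl⟩))
      · rcases Nat.lt_or_ge q i with hiq | hiq
        · obtain rfl : i = q + 1 := by lia
          exact .inl (.inr rfl)
        · exact .inr ⟨i, .inr ⟨hiq, rfl⟩⟩
      · exact .inr ⟨i, .inl ⟨by lia, by push_cast; ring⟩⟩

/-- Horak–Rosa: `{1^a, x^b}` is realized from `0` as soon as `a ≥ ω(x, b)`. -/
theorem trail_of_omegaBHR_le {x a b : ℕ} (hx : 1 < x) (ha : omegaBHR x b ≤ a) :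
    ∃ t, Trail_s6 0 t (a • {1} + b • {x}) {n | 0 ≤ n ∧ n ≤ (a + b : ℕ)} := by
  have hr : b % x < x := Nat.mod_lt _ (by lia)
  have hb : b / x * x + b % x = b := by rw [mul_comm]; exact Nat.div_add_mod b x
  have key : ∃ t, Trail_s6 0 t (omegaBHR x b • {1} + b • {x})
      {n | 0 ≤ n ∧ n ≤ (omegaBHR x b + b : ℕ)} := by
    unfold omegaBHR
    generalize b / x = q at *
    generalize b % x = r at *
    subst hb
    split_ifs with h
    · have h1 : ∃ t, Trail_s6 0 t ((x - 1) • {1} + (q * x + r) • {x})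
          {n | 0 ≤ n ∧ n < (q + 1) * x + r} := by
        rcases Nat.even_or_odd r with he | ho
        · exact trail_of_even hr he
        · refine trail_of_odd hr ho.pos ?_
          rcases h with h | h | h | h
          · exact .inl h
          · exact .inr (.inl h)
          · exact .inr (.inr (by grind))
          · grind
      obtain ⟨t, ht⟩ := h1
      refine ⟨t, ht.mono ?_⟩
      rintro n ⟨h0, hn⟩
      refine ⟨h0, ?_⟩
      push_cast [hx.le] at hn
      linarith
    · push Not at h
      obtain ⟨q, rfl⟩ : ∃ q', q = q' + 1 := ⟨q - 1, by lia⟩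
      obtain ⟨t, ht⟩ := trail_of_odd_odd (q := q) hr (by grind) (by grind)
      refine ⟨t, ht.mono ?_⟩
      rintro n ⟨h0, hn⟩
      refine ⟨h0, ?_⟩
      push_cast at hn
      linarith
  obtain ⟨t, ht⟩ := key
  obtain ⟨k, rfl⟩ := Nat.exists_eq_add_of_le ha
  obtain ⟨t', ht'⟩ := ht.prepend_ones k
  refine ⟨t', ht'.congr rfl rfl (by module) fun n hn => ?_⟩
  simp at hn ⊢
  lia

/-- If `1 < x < y`, `c ≡ 0` or `1 (mod y)`, `a + b = y - 1` and
`a ≥ ω(x, b)`, then `{1^a, x^b, y^c}` has a standard linear realization. -/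
theorem stmt6 (x y a b c : ℕ) (hx : 1 < x) (hxy : x < y)
    (hc : c % y = 0 ∨ c % y = 1) (hab : a + b = y - 1) (ha : omegaBHR x b ≤ a) :
    HasStandardLinearRealization (mset3 a b c x y) := by
  obtain ⟨t, ht⟩ := trail_of_omegaBHR_le hx ha
  obtain ⟨N, rfl⟩ : ∃ N, y = N + 1 := ⟨y - 1, by lia⟩
  obtain rfl : a + b = N := by lia
  have hcdiv := Nat.div_add_mod c (a + b + 1)
  set k := c / (a + b + 1)
  have hcard : (a • {1} + b • {x} : Multiset ℕ).card = a + b := by simp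
  rcases hc with hc | hc
  · rw [hc] at hcdiv
    have h := (ht.zigzag (a + b + 1) k).1
    have hL : a • {1} + b • {x} + ((a + b + 1) * k) • {a + b + 1} =
        mset3 a b c x (a + b + 1) := by
      simp only [mset3, ← Multiset.nsmul_singleton, ← hcdiv]
      rfl
    rw [hcard, hL] at h
    refine h.hasStandardLinearRealization fun n hn => ?_
    simp only [mset3, Multiset.card_add, Multiset.card_replicate] at hn
    obtain ⟨i, j, hj, hij, hi⟩ := exists_add_mul_of_lt (x := a + b + 1) k 0 (by lia)
      (n := n) (by lia) (by norm_cast; nlinarith)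
    exact ⟨j, by simp; lia, i, by lia, hij⟩
  · rw [hc] at hcdiv
    obtain ⟨t', h⟩ := ht.column_append_zigzag
      (by intro h0; rw [h0] at hcard; simp at hcard; lia) (a + b + 1) k
    have hL : a • {1} + b • {x} + ((a + b) * k + (k + 1)) • {a + b + 1} =
        mset3 a b c x (a + b + 1) := by
      simp only [mset3, ← Multiset.nsmul_singleton, ← hcdiv]
      congr 2
      ring
    rw [hcard, hL] at h
    refine h.hasStandardLinearRealization fun n hn => ?_
    simp only [mset3, Multiset.card_add, Multiset.card_replicate] at hn
    obtain ⟨i, j, hj, hij, hi⟩ := exists_add_mul_of_lt (x := a + b + 1) k 1 (by lia)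
      (n := n) (by lia) (by norm_cast; nlinarith)
    rcases Nat.eq_zero_or_pos j with rfl | hj0
    · exact .inl ⟨i, by lia, by simpa using hij⟩
    · exact .inr ⟨(a + b + 1 : ℕ) - j, by simp; lia, by lia, i, by lia, by rw [hij]; ring⟩
end
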